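/- Let u be a weak solution of problem (P), which is therefore locally symmetric, and let A = B_{ρ'}(z) \ closure(B_ρ(z)) (z ∈ B_R, 0 ≤ ρ < ρ' < R) be one of the annuli in the local-symmetry decomposition of u, and let x₀ ∈ ∂A ∩ B_R. If either x₀ ∈ ∂B_ρ(z) and ρ > 0, or x₀ ∈ ∂B_{ρ'}(z) and N ≥ 2, then f(|x₀|, u(x₀)) = 0. -/

import Mathlib

open Set Metric MeasureTheory Bornology
open scoped RealInnerProductSpace Classical

noncomputable section

/-- The vector field `y ↦ (g(|y|)/|y|)·y`, with the convention that it vanishes at `y = 0`. -/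
def gvec {N : ℕ} (g : ℝ → ℝ) (y : EuclideanSpace ℝ (Fin N)) : EuclideanSpace ℝ (Fin N) :=
  if y = 0 then 0 else (g ‖y‖ / ‖y‖) • y

/-- `φ` is a smooth test function compactly supported in `Ω`. -/
def IsTestFun {N : ℕ} (Ω : Set (EuclideanSpace ℝ (Fin N)))
    (φ : EuclideanSpace ℝ (Fin N) → ℝ) : Prop :=
  ContDiff ℝ (⊤ : ℕ∞) φ ∧ HasCompactSupport φ ∧ tsupport φ ⊆ Ω

/-- Conditions (2.1)-(2.2): `g ∈ C[0,∞) ∩ C¹(0,∞)`, `g(0) = 0`, `g'(t) > 0` for `t > 0`. -/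
def GCond (g : ℝ → ℝ) : Prop :=
  ContinuousOn g (Ici 0) ∧ ContDiffOn ℝ 1 g (Ioi 0) ∧ g 0 = 0 ∧
    ∀ t : ℝ, 0 < t → 0 < deriv g t

/-- Conditions (2.3)-(2.4): `f ∈ C([0,R] × [0,∞))`, `r ↦ f(r,t)` non-increasing. -/
def FCond (R : ℝ) (f : ℝ → ℝ → ℝ) : Prop :=
  ContinuousOn (fun q : ℝ × ℝ => f q.1 q.2) (Icc 0 R ×ˢ Ici 0) ∧
    ∀ t : ℝ, 0 ≤ t → ∀ r₁ ∈ Icc (0:ℝ) R, ∀ r₂ ∈ Icc (0:ℝ) R, r₁ ≤ r₂ → f r₂ t ≤ f r₁ t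

/-- `u` solves `-div((g(|∇u|)/|∇u|)∇u) = f(|x|,u)` distributionally in the ball `B_R`. -/
def IsDistribSolBall {N : ℕ} (R : ℝ) (g : ℝ → ℝ) (f : ℝ → ℝ → ℝ)
    (u : EuclideanSpace ℝ (Fin N) → ℝ) : Prop :=
  ∀ φ : EuclideanSpace ℝ (Fin N) → ℝ, IsTestFun (ball 0 R) φ →
    (∫ x in ball (0:EuclideanSpace ℝ (Fin N)) R, ⟪gvec g (gradient u x), gradient φ x⟫) =
      ∫ x in ball (0:EuclideanSpace ℝ (Fin N)) R, f ‖x‖ (u x) * φ x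

/-- `u` is a weak solution of problem (P): `u ∈ C¹(clos B_R)`, `u ≥ 0`, `u ≢ 0`,
`u = 0` on `∂B_R`, and the equation holds distributionally. -/
def IsWeakSolP {N : ℕ} (R : ℝ) (g : ℝ → ℝ) (f : ℝ → ℝ → ℝ)
    (u : EuclideanSpace ℝ (Fin N) → ℝ) : Prop :=
  ContDiffOn ℝ 1 u (closedBall 0 R) ∧
  (∀ x ∈ closedBall (0:EuclideanSpace ℝ (Fin N)) R, 0 ≤ u x) ∧
  (∃ x ∈ closedBall (0:EuclideanSpace ℝ (Fin N)) R, u x ≠ 0) ∧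
  (∀ x ∈ sphere (0:EuclideanSpace ℝ (Fin N)) R, u x = 0) ∧
  IsDistribSolBall R g f u

/-- `U` is `C¹` on `[a,b]` with (continuous) derivative `U'`. -/
def C1On (U U' : ℝ → ℝ) (a b : ℝ) : Prop :=
  ContinuousOn U' (Icc a b) ∧ ∀ r ∈ Icc a b, HasDerivWithinAt U (U' r) (Icc a b) r

/-- Definition 2.1: `u` is locally symmetric in `B_R`. -/
def LocallySymmetric {N : ℕ} (R : ℝ) (u : EuclideanSpace ℝ (Fin N) → ℝ) : Prop :=
  ∃ (K : Set ℕ) (z : ℕ → EuclideanSpace ℝ (Fin N)) (ri ro : ℕ → ℝ) (U U' : ℕ → ℝ → ℝ),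
    (∀ k ∈ K, z k ∈ ball (0:EuclideanSpace ℝ (Fin N)) R ∧ 0 ≤ ri k ∧ ri k < ro k) ∧
    K.PairwiseDisjoint (fun k => ball (z k) (ro k) \ closedBall (z k) (ri k)) ∧
    ball (0:EuclideanSpace ℝ (Fin N)) R =
      (⋃ k ∈ K, ball (z k) (ro k) \ closedBall (z k) (ri k)) ∪
        {x ∈ ball (0:EuclideanSpace ℝ (Fin N)) R | gradient u x = 0} ∧
    ∀ k ∈ K,
      C1On (U k) (U' k) (ri k) (ro k) ∧
      (∀ x ∈ ball (z k) (ro k) \ closedBall (z k) (ri k), u x = U k ‖x - z k‖) ∧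
      (∀ r ∈ Ioo (ri k) (ro k), U' k r < 0) ∧
      (∀ x ∈ ball (z k) (ri k), U k (ri k) ≤ u x)

/-- `H(t) = t·g(t) - ∫₀ᵗ g(s) ds`. -/
def Hfun (g : ℝ → ℝ) (t : ℝ) : ℝ := t * g t - ∫ s in (0:ℝ)..t, g s

/-- The inverse of `H` on `[0,∞)`. -/
def Hinv (g : ℝ → ℝ) : ℝ → ℝ := Function.invFunOn (Hfun g) (Ici 0)

/-- The class `A_g` of Definition 3.1. -/
def MemAg (g φ : ℝ → ℝ) : Prop :=
  ContinuousOn φ (Ici 0) ∧ (∀ t : ℝ, 0 ≤ t → 0 ≤ φ t) ∧ φ 0 = 0 ∧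
  ((∃ d > (0:ℝ), ∀ t ∈ Icc (0:ℝ) d, φ t = 0) ∨
    ∃ δ > (0:ℝ), (∀ t ∈ Ioo (0:ℝ) δ, 0 < φ t) ∧
      ∫⁻ t in Ioc (0:ℝ) δ, ENNReal.ofReal (1 / Hinv g (∫ s in (0:ℝ)..t, φ s)) = ⊤)

/-- `u` satisfies `div((g(|∇u|)/|∇u|)∇u) ≤ φ(u)` distributionally in `Ω`. -/
def DistribSupIneq {N : ℕ} (Ω : Set (EuclideanSpace ℝ (Fin N))) (g φ : ℝ → ℝ)
    (u : EuclideanSpace ℝ (Fin N) → ℝ) : Prop :=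
  ∀ ψ : EuclideanSpace ℝ (Fin N) → ℝ, IsTestFun Ω ψ → (∀ x, 0 ≤ ψ x) →
    -(∫ x in Ω, ⟪gvec g (gradient u x), gradient ψ x⟫) ≤ ∫ x in Ω, φ (u x) * ψ x

/-- Condition (a) of Lemma 3.7. -/
def CondA (R : ℝ) (g : ℝ → ℝ) (f : ℝ → ℝ → ℝ) : Prop :=
  ∀ ρ ∈ Ico (0:ℝ) R, ∀ τ : ℝ, 0 < τ → f ρ τ = 0 →
    ∃ δ ∈ Ioo (0:ℝ) τ, ∃ φ : ℝ → ℝ, MemAg g φ ∧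
      ∀ t ∈ Icc (τ - δ) τ, ∀ r ∈ Icc (ρ - δ) (ρ + δ) ∩ Icc (0:ℝ) R, f r t ≤ φ (τ - t)

/-- Condition (b) of Lemma 3.8. -/
def CondB (R : ℝ) (g : ℝ → ℝ) (f : ℝ → ℝ → ℝ) : Prop :=
  ∀ ρ ∈ Ico (0:ℝ) R, f ρ 0 = 0 →
    ∃ δ > (0:ℝ), ∃ φ : ℝ → ℝ, MemAg g φ ∧
      ∀ r ∈ Ico (0:ℝ) R, ∀ t ∈ Icc (0:ℝ) δ, -f r t ≤ φ t

/-- Condition (c) of Theorem 3.9. -/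
def CondC (R : ℝ) (g : ℝ → ℝ) (f : ℝ → ℝ → ℝ) : Prop :=
  ∀ ρ ∈ Ico (0:ℝ) R, ∀ τ : ℝ, 0 ≤ τ → f ρ τ = 0 →
    ∃ δ > (0:ℝ), ∃ φ : ℝ → ℝ, MemAg g φ ∧
      ∀ t ∈ Icc τ (τ + δ), ∀ r ∈ Icc (ρ - δ) (ρ + δ) ∩ Icc (0:ℝ) R, -f r t ≤ φ (t - τ)

/-- `u` solves `-div((g(|∇u|)/|∇u|)∇u) = f(u)` distributionally in `Ω` (autonomous case). -/
def IsDistribSolAut {N : ℕ} (Ω : Set (EuclideanSpace ℝ (Fin N))) (g f : ℝ → ℝ)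
    (u : EuclideanSpace ℝ (Fin N) → ℝ) : Prop :=
  ∀ φ : EuclideanSpace ℝ (Fin N) → ℝ, IsTestFun Ω φ →
    (∫ x in Ω, ⟪gvec g (gradient u x), gradient φ x⟫) = ∫ x in Ω, f (u x) * φ x

/-- `u` is a weak solution of problem (P) with autonomous right-hand side `f = f(u)`. -/
def IsWeakSolPAut {N : ℕ} (R : ℝ) (g f : ℝ → ℝ) (u : EuclideanSpace ℝ (Fin N) → ℝ) : Prop :=
  ContDiffOn ℝ 1 u (closedBall 0 R) ∧
  (∀ x ∈ closedBall (0:EuclideanSpace ℝ (Fin N)) R, 0 ≤ u x) ∧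
  (∃ x ∈ closedBall (0:EuclideanSpace ℝ (Fin N)) R, u x ≠ 0) ∧
  (∀ x ∈ sphere (0:EuclideanSpace ℝ (Fin N)) R, u x = 0) ∧
  IsDistribSolAut (ball 0 R) g f u

/-- `G(t) = ∫₀ᵗ g(s) ds`. -/
def Gfun (g : ℝ → ℝ) (t : ℝ) : ℝ := ∫ s in (0:ℝ)..t, g s

/-- The variational functional `J(v) = ∫_Ω (G(|∇v|) - F(v)) dx`. -/
def Jfun {N : ℕ} (g f : ℝ → ℝ) (Ω : Set (EuclideanSpace ℝ (Fin N)))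
    (v : EuclideanSpace ℝ (Fin N) → ℝ) : ℝ :=
  ∫ x in Ω, (Gfun g ‖gradient v x‖ - Gfun f (v x))

/-- `v ∈ X`, i.e. `v ∈ C¹(clos Ω)` with `v = 0` on `∂Ω`. -/
def MemX {N : ℕ} (Ω : Set (EuclideanSpace ℝ (Fin N)))
    (v : EuclideanSpace ℝ (Fin N) → ℝ) : Prop :=
  ContDiffOn ℝ 1 v (closure Ω) ∧ ∀ x ∈ frontier Ω, v x = 0

/-- `u` is a global minimizer of `J` in `X`. -/
def IsGlobalMinJ {N : ℕ} (g f : ℝ → ℝ) (Ω : Set (EuclideanSpace ℝ (Fin N)))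
    (u : EuclideanSpace ℝ (Fin N) → ℝ) : Prop :=
  MemX Ω u ∧ ∀ v, MemX Ω v → Jfun g f Ω u ≤ Jfun g f Ω v

/-- `u` is a local minimizer of `J` in `X` (w.r.t. the `C¹` distance). -/
def IsLocalMinJ {N : ℕ} (g f : ℝ → ℝ) (Ω : Set (EuclideanSpace ℝ (Fin N)))
    (u : EuclideanSpace ℝ (Fin N) → ℝ) : Prop :=
  MemX Ω u ∧ ∃ ε > (0:ℝ), ∀ v, MemX Ω v →
    (∀ x ∈ Ω, |v x - u x| + ‖gradient v x - gradient u x‖ < ε) →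
    Jfun g f Ω u ≤ Jfun g f Ω v

/-- `Ω` has `C¹` boundary: near every boundary point, `Ω` is the sublevel set of a `C¹`
defining function with nonvanishing gradient. -/
def HasC1Boundary {N : ℕ} (Ω : Set (EuclideanSpace ℝ (Fin N))) : Prop :=
  ∀ y ∈ frontier Ω, ∃ (V : Set (EuclideanSpace ℝ (Fin N))) (ρ : EuclideanSpace ℝ (Fin N) → ℝ),
    IsOpen V ∧ y ∈ V ∧ ContDiffOn ℝ 1 ρ V ∧ (∀ x ∈ V, (x ∈ Ω ↔ ρ x < 0)) ∧ gradient ρ y ≠ 0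

/-- The Neumann condition `∂u/∂ν = 0` on `∂Ω`; for `u ∈ X` (so that `u` vanishes on the
boundary and all tangential derivatives vanish) this is equivalent to the vanishing of the
full derivative of `u` (within `clos Ω`) at every boundary point. -/
def NeumannZero {N : ℕ} (Ω : Set (EuclideanSpace ℝ (Fin N)))
    (u : EuclideanSpace ℝ (Fin N) → ℝ) : Prop :=
  ∀ y ∈ frontier Ω, HasFDerivWithinAt u (0 : EuclideanSpace ℝ (Fin N) →L[ℝ] ℝ) (closure Ω) y

/-- `u` is radially symmetric and radially non-increasing on `clos B_R`, with `C¹`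
profile `U` (with derivative `U'`). -/
def RadialNonincreasing {N : ℕ} (R : ℝ) (u : EuclideanSpace ℝ (Fin N) → ℝ)
    (U U' : ℝ → ℝ) : Prop :=
  C1On U U' 0 R ∧ AntitoneOn U (Icc 0 R) ∧
    ∀ x ∈ closedBall (0:EuclideanSpace ℝ (Fin N)) R, u x = U ‖x‖

end


lemma st_deriv_nonneg (t : ℝ) : 0 ≤ deriv Real.smoothTransition t :=
  Real.smoothTransition.monotone.deriv_nonneg

lemma st_deriv_zero_of_nonpos {t : ℝ} (ht : t ≤ 0) : deriv Real.smoothTransition t = 0 := by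
  apply IsLocalMin.deriv_eq_zero
  refine Filter.Eventually.of_forall fun s => ?_
  rw [Real.smoothTransition.zero_of_nonpos ht]
  exact Real.smoothTransition.nonneg s

lemma st_deriv_zero_of_one_le {t : ℝ} (ht : 1 ≤ t) : deriv Real.smoothTransition t = 0 := by
  apply IsLocalMax.deriv_eq_zero
  refine Filter.Eventually.of_forall fun s => ?_
  rw [Real.smoothTransition.one_of_one_le ht]
  exact Real.smoothTransition.le_one s

lemma st_deriv_bound : ∃ C : ℝ, 0 < C ∧ ∀ t, deriv Real.smoothTransition t ≤ C := by
  have hc : Continuous (deriv Real.smoothTransition) :=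
    (Real.smoothTransition.contDiff (n := 1)).continuous_deriv le_rfl
  obtain ⟨C, hC⟩ := (isCompact_Icc (a := (0:ℝ)) (b := 1)).exists_bound_of_continuousOn hc.continuousOn
  refine ⟨|C| + 1, by positivity, fun t => ?_⟩
  by_cases h0 : t ≤ 0
  · rw [st_deriv_zero_of_nonpos h0]; positivity
  by_cases h1 : 1 ≤ t
  · rw [st_deriv_zero_of_one_le h1]; positivity
  push Not at h0 h1
  have := hC t ⟨h0.le, h1.le⟩
  rw [Real.norm_eq_abs] at this
  linarith [le_abs_self (deriv Real.smoothTransition t), le_abs_self C]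

lemma st_hasDerivAt (t : ℝ) :
    HasDerivAt Real.smoothTransition (deriv Real.smoothTransition t) t :=
  ((Real.smoothTransition.contDiff (n := 1)).differentiable one_ne_zero t).hasDerivAt

/-- The test functions used throughout. -/
noncomputable def psiFun {N : ℕ} (z y : EuclideanSpace ℝ (Fin N)) (d σ ρ2 δ : ℝ)
    (x : EuclideanSpace ℝ (Fin N)) : ℝ :=
  Real.smoothTransition ((σ * (‖x - z‖ ^ 2 - ρ2) - δ) / δ) *
    Real.smoothTransition (d ^ 2 - ‖x - y‖ ^ 2)

lemma psi_gradient {N : ℕ} (z y : EuclideanSpace ℝ (Fin N)) (d σ ρ2 δ : ℝ)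
    (x : EuclideanSpace ℝ (Fin N)) :
    gradient (psiFun z y d σ ρ2 δ) x =
      (deriv Real.smoothTransition ((σ * (‖x - z‖ ^ 2 - ρ2) - δ) / δ) * (2 * σ / δ) *
        Real.smoothTransition (d ^ 2 - ‖x - y‖ ^ 2)) • (x - z) -
      (2 * Real.smoothTransition ((σ * (‖x - z‖ ^ 2 - ρ2) - δ) / δ) *
        deriv Real.smoothTransition (d ^ 2 - ‖x - y‖ ^ 2)) • (x - y) := by
  apply HasGradientAt.gradient
  rw [hasGradientAt_iff_hasFDerivAt]
  have hz : HasFDerivAt (fun x : EuclideanSpace ℝ (Fin N) => ‖x - z‖ ^ 2) _ x :=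
    ((hasFDerivAt_id x).sub_const z).norm_sq
  have hy : HasFDerivAt (fun x : EuclideanSpace ℝ (Fin N) => ‖x - y‖ ^ 2) _ x :=
    ((hasFDerivAt_id x).sub_const y).norm_sq
  have ha := (((hz.sub_const ρ2).const_mul σ).sub_const δ).mul_const (δ⁻¹)
  have hb := hy.const_sub (d ^ 2)
  have hA := (st_hasDerivAt ((σ * (‖x - z‖ ^ 2 - ρ2) - δ) * δ⁻¹)).comp_hasFDerivAt x ha
  have hB := (st_hasDerivAt (d ^ 2 - ‖x - y‖ ^ 2)).comp_hasFDerivAt x hb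
  have := hA.mul hB
  simp only [div_eq_mul_inv]
  refine (this.congr_fderiv ?_).congr_of_eventuallyEq (Filter.Eventually.of_forall fun _ => ?_)
  · ext v
    simp [InnerProductSpace.toDual_apply_apply, inner_sub_left, inner_smul_left]
    ring
  · simp [psiFun, div_eq_mul_inv]

lemma psi_contDiff {N : ℕ} (z y : EuclideanSpace ℝ (Fin N)) (d σ ρ2 δ : ℝ) :
    ContDiff ℝ (⊤ : ℕ∞) (psiFun z y d σ ρ2 δ) := by
  unfold psiFun
  have h1 : ContDiff ℝ (⊤ : ℕ∞) (fun x : EuclideanSpace ℝ (Fin N) => ‖x - z‖ ^ 2) :=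
    (contDiff_id.sub contDiff_const).norm_sq ℝ
  have h2 : ContDiff ℝ (⊤ : ℕ∞) (fun x : EuclideanSpace ℝ (Fin N) => ‖x - y‖ ^ 2) :=
    (contDiff_id.sub contDiff_const).norm_sq ℝ
  refine ContDiff.mul (Real.smoothTransition.contDiff.comp ?_)
    (Real.smoothTransition.contDiff.comp ?_)
  · exact ((contDiff_const.mul (h1.sub contDiff_const)).sub contDiff_const).div_const _
  · exact contDiff_const.sub h2

lemma psi_nonneg {N : ℕ} (z y : EuclideanSpace ℝ (Fin N)) (d σ ρ2 δ : ℝ)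
    (x : EuclideanSpace ℝ (Fin N)) : 0 ≤ psiFun z y d σ ρ2 δ x :=
  mul_nonneg (Real.smoothTransition.nonneg _) (Real.smoothTransition.nonneg _)

lemma psi_zero_of_not_ball {N : ℕ} (z y : EuclideanSpace ℝ (Fin N)) {d σ ρ2 δ : ℝ} (hd : 0 < d)
    {x : EuclideanSpace ℝ (Fin N)} (hx : x ∉ ball y d) : d ^ 2 - ‖x - y‖ ^ 2 ≤ 0 := by
  rw [mem_ball, dist_eq_norm, not_lt] at hx
  nlinarith

lemma psi_tsupport {N : ℕ} (z y : EuclideanSpace ℝ (Fin N)) {d σ ρ2 δ : ℝ} (hd : 0 < d) :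
    tsupport (psiFun z y d σ ρ2 δ) ⊆ closedBall y d := by
  refine closure_minimal ?_ isClosed_closedBall
  intro x hx
  by_contra hx'
  apply hx
  have : x ∉ ball y d := fun h => hx' (ball_subset_closedBall h)
  unfold psiFun
  rw [Real.smoothTransition.zero_of_nonpos (psi_zero_of_not_ball (σ := σ) (ρ2 := ρ2) (δ := δ) z y hd this), mul_zero]

lemma psi_isTest {N : ℕ} (z y : EuclideanSpace ℝ (Fin N)) {d σ ρ2 δ R : ℝ} (hd : 0 < d)
    (hD : closedBall y d ⊆ ball (0 : EuclideanSpace ℝ (Fin N)) R) :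
    IsTestFun (ball 0 R) (psiFun z y d σ ρ2 δ) :=
  ⟨psi_contDiff _ _ _ _ _ _,
    (isCompact_closedBall y d).of_isClosed_subset (isClosed_tsupport _) (psi_tsupport z y hd),
    (psi_tsupport z y hd).trans hD⟩

lemma flux {N : ℕ} {R : ℝ} {g : ℝ → ℝ} {f : ℝ → ℝ → ℝ} {u : EuclideanSpace ℝ (Fin N) → ℝ}
    (hdist : IsDistribSolBall R g f u)
    (hcont : ContinuousOn (fun x => f ‖x‖ (u x)) (ball (0 : EuclideanSpace ℝ (Fin N)) R))
    (z y : EuclideanSpace ℝ (Fin N)) (d σ ρ2 c M δ1 : ℝ) (hd : 0 < d)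
    (hD : closedBall y d ⊆ ball (0 : EuclideanSpace ℝ (Fin N)) R)
    (κ : EuclideanSpace ℝ (Fin N) → ℝ)
    (hV : ∀ x ∈ ball y d, 0 < σ * (‖x - z‖ ^ 2 - ρ2) →
      gvec g (gradient u x) = -(κ x) • (x - z))
    (hκ : ∀ x ∈ ball y d, 0 < σ * (‖x - z‖ ^ 2 - ρ2) → 0 ≤ κ x)
    (hκ2 : ∀ x ∈ ball y d, 0 < σ * (‖x - z‖ ^ 2 - ρ2) → 0 ≤ κ x * (σ * ⟪x - z, x - y⟫))
    (hsm : ∀ ε > 0, ∃ τ > 0, ∀ x ∈ ball y d, 0 < σ * (‖x - z‖ ^ 2 - ρ2) →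
      σ * (‖x - z‖ ^ 2 - ρ2) < τ → κ x * ‖x - z‖ ≤ ε)
    (hσ : σ ^ 2 = 1) (hc : 0 < c)
    (hh : ∀ x ∈ ball y d, 0 < σ * (‖x - z‖ ^ 2 - ρ2) → σ * f ‖x‖ (u x) ≤ -c)
    (hM : 0 ≤ M) (hδ1 : 0 < δ1)
    (hvol : ∀ δ, 0 < δ → δ < δ1 → ∃ rm, 0 ≤ rm ∧
      (∀ x ∈ ball y d, δ ≤ σ * (‖x - z‖ ^ 2 - ρ2) → σ * (‖x - z‖ ^ 2 - ρ2) ≤ 2 * δ →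
        ‖x - z‖ ≤ rm) ∧
      rm * volume.real {x : EuclideanSpace ℝ (Fin N) | x ∈ ball y d ∧
        δ ≤ σ * (‖x - z‖ ^ 2 - ρ2) ∧ σ * (‖x - z‖ ^ 2 - ρ2) ≤ 2 * δ} ≤ M * δ)
    (hne : ∃ x ∈ ball y d, 0 < σ * (‖x - z‖ ^ 2 - ρ2)) : False := by
  obtain ⟨C, hC0, hC⟩ := st_deriv_bound
  obtain ⟨x1, hx1, hx1p⟩ := hne
  have hψint : ∀ δ, IntegrableOn (psiFun z y d σ ρ2 δ) (ball (0 : EuclideanSpace ℝ (Fin N)) R) := by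
    intro δ
    exact ((psi_contDiff z y d σ ρ2 δ).continuous.integrable_of_hasCompactSupport
      (psi_isTest z y hd hD).2.1).integrableOn
  -- main estimate
  have key : ∀ ε > 0, ∃ τ > 0, ∀ δ, 0 < δ → δ < τ →
      c * ∫ x in ball (0 : EuclideanSpace ℝ (Fin N)) R, psiFun z y d σ ρ2 δ x ≤
        2 * C * ε * M := by
    intro ε hε
    obtain ⟨τ, hτ, hτs⟩ := hsm ε hε
    refine ⟨min (τ / 3) δ1, by positivity, fun δ hδ hδτ => ?_⟩
    have hδ3 : δ < τ / 3 := lt_of_lt_of_le hδτ (min_le_left _ _)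
    obtain ⟨rm, hrm0, hrm, hrmv⟩ := hvol δ hδ (lt_of_lt_of_le hδτ (min_le_right _ _))
    set T : Set (EuclideanSpace ℝ (Fin N)) := {x | x ∈ ball y d ∧
        δ ≤ σ * (‖x - z‖ ^ 2 - ρ2) ∧ σ * (‖x - z‖ ^ 2 - ρ2) ≤ 2 * δ} with hT
    have hTm : MeasurableSet T := by
      have hcc : Continuous fun x : EuclideanSpace ℝ (Fin N) => σ * (‖x - z‖ ^ 2 - ρ2) := by
        fun_prop
      exact measurableSet_ball.inter
        ((isClosed_le continuous_const hcc).measurableSet.inter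
          (isClosed_le hcc continuous_const).measurableSet)
    have hTsub : T ⊆ ball y d := fun x hx => hx.1
    have hTfin : volume T ≠ ⊤ := ((measure_mono hTsub).trans_lt measure_ball_lt_top).ne
    have heq := hdist _ (psi_isTest (σ := σ) (ρ2 := ρ2) (δ := δ) z y hd hD)
    set B : ℝ := 2 * C * ε * rm / δ with hB
    have hB0 : 0 ≤ B := by positivity
    -- pointwise bound
    have hpt : ∀ x, -(T.indicator (fun _ => B) x) ≤
        σ * ⟪gvec g (gradient u x), gradient (psiFun z y d σ ρ2 δ) x⟫ := by
      intro x
      have hind : 0 ≤ T.indicator (fun _ => B) x := indicator_nonneg (fun _ _ => hB0) x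
      rw [psi_gradient]
      by_cases hxD : x ∈ ball y d
      swap
      · have h0 := psi_zero_of_not_ball (σ := σ) (ρ2 := ρ2) (δ := δ) z y hd hxD
        rw [Real.smoothTransition.zero_of_nonpos h0, st_deriv_zero_of_nonpos h0]
        simpa using hind
      by_cases hs : σ * (‖x - z‖ ^ 2 - ρ2) ≤ δ
      · by_cases hs' : σ * (‖x - z‖ ^ 2 - ρ2) - δ ≤ 0
        · have h0 : (σ * (‖x - z‖ ^ 2 - ρ2) - δ) / δ ≤ 0 := div_nonpos_of_nonpos_of_nonneg hs' hδ.le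
          rw [Real.smoothTransition.zero_of_nonpos h0, st_deriv_zero_of_nonpos h0]
          simpa using hind
        · exact absurd (by linarith) hs'
      push Not at hs
      have hpos : 0 < σ * (‖x - z‖ ^ 2 - ρ2) := hδ.trans hs
      rw [hV x hxD hpos]
      set s1 := deriv Real.smoothTransition ((σ * (‖x - z‖ ^ 2 - ρ2) - δ) / δ) with hs1
      set s0 := Real.smoothTransition ((σ * (‖x - z‖ ^ 2 - ρ2) - δ) / δ) with hs0
      set b0 := Real.smoothTransition (d ^ 2 - ‖x - y‖ ^ 2) with hb0
      set b1 := deriv Real.smoothTransition (d ^ 2 - ‖x - y‖ ^ 2) with hb1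
      have e1 : σ * ⟪-(κ x) • (x - z), (s1 * (2 * σ / δ) * b0) • (x - z) - (2 * s0 * b1) • (x - y)⟫
          = -(κ x * ‖x - z‖) * ‖x - z‖ * (2 / δ) * s1 * b0 * σ ^ 2
            + 2 * s0 * b1 * (κ x * (σ * ⟪x - z, x - y⟫)) := by
        rw [inner_smul_left, inner_sub_right, inner_smul_right, inner_smul_right,
          real_inner_self_eq_norm_sq]
        simp
        ring
      rw [e1, hσ, mul_one]
      have p1 : 0 ≤ 2 * s0 * b1 * (κ x * (σ * ⟪x - z, x - y⟫)) := by
        have := hκ2 x hxD hpos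
        have h1 : 0 ≤ s0 := Real.smoothTransition.nonneg _
        have h2 : 0 ≤ b1 := st_deriv_nonneg _
        positivity
      have hb0' : 0 ≤ b0 := Real.smoothTransition.nonneg _
      have hb0'' : b0 ≤ 1 := Real.smoothTransition.le_one _
      have hs1' : 0 ≤ s1 := st_deriv_nonneg _
      by_cases hxT : σ * (‖x - z‖ ^ 2 - ρ2) ≤ 2 * δ
      · have hxT' : x ∈ T := ⟨hxD, hs.le, hxT⟩
        rw [indicator_of_mem hxT']
        have hk := hτs x hxD hpos (by linarith)
        have hk0 := hκ x hxD hpos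
        have hr := hrm x hxD hs.le hxT
        have : κ x * ‖x - z‖ * ‖x - z‖ * (2 / δ) * s1 * b0 ≤ ε * rm * (2 / δ) * C * 1 := by
          have := hC ((σ * (‖x - z‖ ^ 2 - ρ2) - δ) / δ)
          gcongr
        have e2 : ε * rm * (2 / δ) * C * 1 = B := by rw [hB]; ring
        linarith
      · have : s1 = 0 := by
          apply st_deriv_zero_of_one_le
          rw [le_div_iff₀ hδ]; linarith
        rw [this]
        have : 0 ≤ T.indicator (fun _ => B) x := hind
        linarith
    have hindint : IntegrableOn (T.indicator (fun _ => B)) (ball (0 : EuclideanSpace ℝ (Fin N)) R) := by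
      apply Integrable.integrableOn
      exact (integrable_indicator_iff hTm).2 (integrableOn_const hTfin)
    have hindval : ∫ x in ball (0 : EuclideanSpace ℝ (Fin N)) R, T.indicator (fun _ => B) x
        ≤ 2 * C * ε * M := by
      have h1 : ∫ x in ball (0 : EuclideanSpace ℝ (Fin N)) R, T.indicator (fun _ => B) x
          ≤ ∫ x, T.indicator (fun _ => B) x := by
        apply setIntegral_le_integral ((integrable_indicator_iff hTm).2 (integrableOn_const hTfin))
        exact Filter.Eventually.of_forall fun x => indicator_nonneg (fun _ _ => hB0) x
      have h2 : ∫ x, T.indicator (fun _ => B) x = volume.real T * B := by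
        rw [integral_indicator hTm]; simp
      rw [h2] at h1
      refine h1.trans ?_
      have : volume.real T * B = (2 * C * ε / δ) * (rm * volume.real T) := by rw [hB]; ring
      rw [this]
      calc (2 * C * ε / δ) * (rm * volume.real T) ≤ (2 * C * ε / δ) * (M * δ) := by gcongr
        _ = 2 * C * ε * M := by field_simp
    -- left-hand side
    have hL : -(2 * C * ε * M) ≤ σ * ∫ x in ball (0 : EuclideanSpace ℝ (Fin N)) R,
        ⟪gvec g (gradient u x), gradient (psiFun z y d σ ρ2 δ) x⟫ := by
      by_cases hintg : IntegrableOn (fun x => ⟪gvec g (gradient u x), gradient (psiFun z y d σ ρ2 δ) x⟫)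
          (ball (0 : EuclideanSpace ℝ (Fin N)) R)
      · rw [← integral_const_mul]
        have := integral_mono (hindint.neg) (hintg.const_mul σ) hpt
        simp only [Pi.neg_apply, integral_neg] at this
        linarith
      · rw [integral_undef hintg, mul_zero]
        have : 0 ≤ 2 * C * ε * M := by positivity
        linarith
    rw [heq] at hL
    have hRint : IntegrableOn (fun x => f ‖x‖ (u x) * psiFun z y d σ ρ2 δ x)
        (ball (0 : EuclideanSpace ℝ (Fin N)) R) := by
      have h1 : IntegrableOn (fun x => f ‖x‖ (u x) * psiFun z y d σ ρ2 δ x) (closedBall y d) := by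
        apply ContinuousOn.integrableOn_compact (isCompact_closedBall y d)
        exact (hcont.mono hD).mul (psi_contDiff z y d σ ρ2 δ).continuous.continuousOn
      have h2 : Integrable (fun x => f ‖x‖ (u x) * psiFun z y d σ ρ2 δ x) := by
        rw [integrableOn_iff_integrable_of_support_subset] at h1
        · exact h1
        · intro x hx
          apply psi_tsupport (σ := σ) (ρ2 := ρ2) (δ := δ) z y hd
          apply subset_tsupport
          intro h0
          apply hx
          simp [h0]
      exact h2.integrableOn
    have hRb : c * ∫ x in ball (0 : EuclideanSpace ℝ (Fin N)) R, psiFun z y d σ ρ2 δ x ≤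
        -(σ * ∫ x in ball (0 : EuclideanSpace ℝ (Fin N)) R, f ‖x‖ (u x) * psiFun z y d σ ρ2 δ x) := by
      rw [← integral_const_mul, ← integral_const_mul, ← integral_neg]
      refine integral_mono ((hψint δ).const_mul c) ((hRint.const_mul σ).neg) fun x => ?_
      show c * psiFun z y d σ ρ2 δ x ≤ -(σ * (f ‖x‖ (u x) * psiFun z y d σ ρ2 δ x))
      by_cases h0 : psiFun z y d σ ρ2 δ x = 0
      · simp [h0]
      have hxD : x ∈ ball y d := by
        by_contra hxD
        apply h0
        unfold psiFun
        rw [Real.smoothTransition.zero_of_nonpos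
          (psi_zero_of_not_ball (σ := σ) (ρ2 := ρ2) (δ := δ) z y hd hxD), mul_zero]
      have hpos : 0 < σ * (‖x - z‖ ^ 2 - ρ2) := by
        by_contra hpos
        apply h0
        unfold psiFun
        rw [Real.smoothTransition.zero_of_nonpos, zero_mul]
        apply div_nonpos_of_nonpos_of_nonneg _ hδ.le
        linarith
      have := hh x hxD hpos
      nlinarith [psi_nonneg z y d σ ρ2 δ x]
    linarith
  -- positivity of a fixed integral
  set s := σ * (‖x1 - z‖ ^ 2 - ρ2) with hs
  set δ0 := s / 2 with hδ0
  have hδpos : 0 < δ0 := by positivity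
  have hIpos : 0 < ∫ x in ball (0 : EuclideanSpace ℝ (Fin N)) R, psiFun z y d σ ρ2 δ0 x := by
    have hx1R : x1 ∈ ball (0 : EuclideanSpace ℝ (Fin N)) R := hD (ball_subset_closedBall hx1)
    rw [setIntegral_pos_iff_support_of_nonneg_ae
      (Filter.Eventually.of_forall fun x => psi_nonneg _ _ _ _ _ _ x) (hψint δ0)]
    have hop : IsOpen (Function.support (psiFun z y d σ ρ2 δ0) ∩
        ball (0 : EuclideanSpace ℝ (Fin N)) R) :=
      ((psi_contDiff z y d σ ρ2 δ0).continuous.isOpen_support).inter isOpen_ball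
    refine hop.measure_pos _ ⟨x1, ?_, hx1R⟩
    rw [Function.mem_support]
    apply ne_of_gt
    apply mul_pos <;> apply Real.smoothTransition.pos_of_pos
    · apply div_pos _ hδpos
      rw [← hs]; linarith
    · rw [mem_ball, dist_eq_norm] at hx1
      nlinarith [norm_nonneg (x1 - y)]
  have hmono : ∀ δ, 0 < δ → δ ≤ δ0 →
      ∫ x in ball (0 : EuclideanSpace ℝ (Fin N)) R, psiFun z y d σ ρ2 δ0 x ≤
      ∫ x in ball (0 : EuclideanSpace ℝ (Fin N)) R, psiFun z y d σ ρ2 δ x := by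
    intro δ hδ hle
    refine integral_mono (hψint δ0) (hψint δ) fun x => ?_
    apply mul_le_mul_of_nonneg_right _ (Real.smoothTransition.nonneg _)
    by_cases h : σ * (‖x - z‖ ^ 2 - ρ2) ≤ 0
    · rw [Real.smoothTransition.zero_of_nonpos]
      · exact Real.smoothTransition.nonneg _
      · apply div_nonpos_of_nonpos_of_nonneg _ hδpos.le
        linarith
    · apply Real.smoothTransition.monotone
      push Not at h
      rw [sub_div, sub_div, div_self hδ.ne', div_self hδpos.ne']
      gcongr
  set I0 := ∫ x in ball (0 : EuclideanSpace ℝ (Fin N)) R, psiFun z y d σ ρ2 δ0 x with hI0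
  obtain ⟨τ, hτ, hk⟩ := key (c * I0 / (4 * C * (M + 1))) (by positivity)
  have hδp : 0 < min (τ / 2) δ0 := by positivity
  have h1 := hk (min (τ / 2) δ0) hδp (lt_of_le_of_lt (min_le_left _ _) (by linarith))
  have h2 := hmono (min (τ / 2) δ0) hδp (min_le_right _ _)
  have h3 : 2 * C * (c * I0 / (4 * C * (M + 1))) * M < c * I0 := by
    have : 2 * C * (c * I0 / (4 * C * (M + 1))) * M = (c * I0) * (M / (2 * (M + 1))) := by
      field_simp; ring
    rw [this]
    have : M / (2 * (M + 1)) < 1 := by rw [div_lt_one (by positivity)]; linarith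
    have h4 : 0 < c * I0 := by positivity
    nlinarith
  nlinarith

lemma sq_eq_one_iff_cases {σ : ℝ} (hσ : σ ^ 2 = 1) : σ = 1 ∨ σ = -1 := by
  simpa using hσ

lemma vol_pos {N : ℕ} (z y : EuclideanSpace ℝ (Fin N)) (d σ ρ : ℝ) (hρ : 0 < ρ) (hσ : σ ^ 2 = 1) :
    ∃ M δ1 : ℝ, 0 ≤ M ∧ 0 < δ1 ∧ ∀ δ, 0 < δ → δ < δ1 → ∃ rm, 0 ≤ rm ∧
      (∀ x ∈ ball y d, δ ≤ σ * (‖x - z‖ ^ 2 - ρ ^ 2) → σ * (‖x - z‖ ^ 2 - ρ ^ 2) ≤ 2 * δ →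
        ‖x - z‖ ≤ rm) ∧
      rm * volume.real {x : EuclideanSpace ℝ (Fin N) | x ∈ ball y d ∧
        δ ≤ σ * (‖x - z‖ ^ 2 - ρ ^ 2) ∧ σ * (‖x - z‖ ^ 2 - ρ ^ 2) ≤ 2 * δ} ≤ M * δ := by
  set ω := volume.real (ball (0 : EuclideanSpace ℝ (Fin N)) 1) with hω
  have hω0 : 0 ≤ ω := measureReal_nonneg
  refine ⟨2 * ρ * (ω * ((4 / ρ) * N * (2 * ρ) ^ (N - 1))), ρ ^ 2 / 4, by positivity, by positivity,
    fun δ hδ hδ1 => ?_⟩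
  set t := 2 * δ / ρ with ht
  have ht0 : 0 < t := by positivity
  have htρ : t * ρ = 2 * δ := by rw [ht]; field_simp
  have htle : t < ρ := by nlinarith
  have hr : ∀ x : EuclideanSpace ℝ (Fin N), δ ≤ σ * (‖x - z‖ ^ 2 - ρ ^ 2) →
      σ * (‖x - z‖ ^ 2 - ρ ^ 2) ≤ 2 * δ → |‖x - z‖ - ρ| ≤ t := by
    intro x h1 h2
    have hn := norm_nonneg (x - z)
    have : |‖x - z‖ ^ 2 - ρ ^ 2| ≤ 2 * δ := by
      rcases sq_eq_one_iff_cases hσ with h | h <;> rw [h] at h1 h2 <;>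
      rw [abs_le] <;> constructor <;> linarith
    have e : |‖x - z‖ ^ 2 - ρ ^ 2| = |‖x - z‖ - ρ| * (‖x - z‖ + ρ) := by
      rw [sq_sub_sq, abs_mul, abs_of_nonneg (by positivity : 0 ≤ ‖x - z‖ + ρ), mul_comm]
    rw [e] at this
    have h3 : |‖x - z‖ - ρ| * ρ ≤ t * ρ := by
      rw [htρ]
      refine le_trans ?_ this
      gcongr; linarith
    exact le_of_mul_le_mul_right h3 hρ
  refine ⟨2 * ρ, by positivity, fun x _ h1 h2 => ?_, ?_⟩
  · have := abs_le.1 (hr x h1 h2)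
    linarith
  · rw [mul_assoc (2 * ρ) _ δ]
    apply mul_le_mul_of_nonneg_left _ (by positivity : (0:ℝ) ≤ 2 * ρ)
    have hsub : {x : EuclideanSpace ℝ (Fin N) | x ∈ ball y d ∧
        δ ≤ σ * (‖x - z‖ ^ 2 - ρ ^ 2) ∧ σ * (‖x - z‖ ^ 2 - ρ ^ 2) ≤ 2 * δ} ⊆
        closedBall z (ρ + t) \ ball z (ρ - t) := by
      rintro x ⟨-, h1, h2⟩
      have := abs_le.1 (hr x h1 h2)
      simp only [mem_diff, mem_closedBall, mem_ball, dist_eq_norm]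
      constructor <;> linarith
    have hfin : volume (closedBall z (ρ + t) \ ball z (ρ - t)) ≠ ⊤ :=
      ((measure_mono diff_subset).trans_lt measure_closedBall_lt_top).ne
    refine (measureReal_mono hsub hfin).trans ?_
    rw [measureReal_diff (ball_subset_closedBall.trans (closedBall_subset_closedBall (by linarith)))
      measurableSet_ball (measure_closedBall_lt_top).ne]
    have hballv : volume.real (ball z (ρ - t)) =
        (ρ - t) ^ Module.finrank ℝ (EuclideanSpace ℝ (Fin N)) * ω := by
      have hpos : 0 < ρ - t := by linarith
      rw [measureReal_def, Measure.addHaar_ball_of_pos _ _ hpos, ENNReal.toReal_mul,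
        ENNReal.toReal_ofReal (by positivity), hω, measureReal_def]
    rw [Measure.addHaar_real_closedBall _ _ (by linarith), hballv]
    rw [finrank_euclideanSpace_fin, ← sub_mul, mul_comm, ← hω]
    have hp : (ρ + t) ^ N - (ρ - t) ^ N ≤ 4 / ρ * N * (2 * ρ) ^ (N - 1) * δ := by
      refine (le_abs_self _).trans ((abs_pow_sub_pow_le _ _ _).trans ?_)
      have e1 : |ρ + t - (ρ - t)| = 4 / ρ * δ := by
        rw [abs_of_nonneg (by linarith), ht]; ring
      have e2 : max |ρ + t| |ρ - t| ≤ 2 * ρ := by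
        apply max_le <;> rw [abs_le] <;> constructor <;> linarith
      rw [e1]
      calc 4 / ρ * δ * N * max |ρ + t| |ρ - t| ^ (N - 1) ≤ 4 / ρ * δ * N * (2 * ρ) ^ (N - 1) := by
            gcongr
        _ = _ := by ring
    calc ω * ((ρ + t) ^ N - (ρ - t) ^ N) ≤ ω * (4 / ρ * N * (2 * ρ) ^ (N - 1) * δ) := by gcongr
      _ = _ := by ring

lemma vol_zero {N : ℕ} (hN : 1 ≤ N) (z y : EuclideanSpace ℝ (Fin N)) (d : ℝ) :
    ∃ M δ1 : ℝ, 0 ≤ M ∧ 0 < δ1 ∧ ∀ δ, 0 < δ → δ < δ1 → ∃ rm, 0 ≤ rm ∧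
      (∀ x ∈ ball y d, δ ≤ 1 * (‖x - z‖ ^ 2 - 0 ^ 2) → 1 * (‖x - z‖ ^ 2 - 0 ^ 2) ≤ 2 * δ →
        ‖x - z‖ ≤ rm) ∧
      rm * volume.real {x : EuclideanSpace ℝ (Fin N) | x ∈ ball y d ∧
        δ ≤ 1 * (‖x - z‖ ^ 2 - 0 ^ 2) ∧ 1 * (‖x - z‖ ^ 2 - 0 ^ 2) ≤ 2 * δ} ≤ M * δ := by
  set ω := volume.real (ball (0 : EuclideanSpace ℝ (Fin N)) 1) with hω
  have hω0 : 0 ≤ ω := measureReal_nonneg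
  refine ⟨2 * ω, 1 / 2, by positivity, by positivity, fun δ hδ hδ1 => ?_⟩
  have hr : ∀ x : EuclideanSpace ℝ (Fin N), 1 * (‖x - z‖ ^ 2 - 0 ^ 2) ≤ 2 * δ →
      ‖x - z‖ ≤ √(2 * δ) := by
    intro x h
    apply Real.le_sqrt_of_sq_le
    linarith
  refine ⟨√(2 * δ), by positivity, fun x _ _ h2 => hr x h2, ?_⟩
  have hsub : {x : EuclideanSpace ℝ (Fin N) | x ∈ ball y d ∧
        δ ≤ 1 * (‖x - z‖ ^ 2 - 0 ^ 2) ∧ 1 * (‖x - z‖ ^ 2 - 0 ^ 2) ≤ 2 * δ} ⊆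
        closedBall z (√(2 * δ)) := by
    rintro x ⟨-, h1, h2⟩
    simpa [dist_eq_norm] using hr x h2
  have h1 := measureReal_mono hsub (measure_closedBall_lt_top (μ := volume)).ne
  rw [Measure.addHaar_real_closedBall _ _ (by positivity), finrank_euclideanSpace_fin] at h1
  have hs1 : √(2 * δ) ≤ 1 := by rw [Real.sqrt_le_one]; linarith
  have h2 : √(2 * δ) ^ N ≤ √(2 * δ) := by
    calc √(2 * δ) ^ N ≤ √(2 * δ) ^ 1 := pow_le_pow_of_le_one (by positivity) hs1 hN
      _ = _ := pow_one _
  calc _ ≤ √(2 * δ) * (√(2 * δ) ^ N * ω) := by gcongr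
    _ ≤ √(2 * δ) * (√(2 * δ) * ω) := by gcongr
    _ = (√(2 * δ) * √(2 * δ)) * ω := by ring
    _ = 2 * ω * δ := by rw [Real.mul_self_sqrt (by positivity)]; ring

lemma vol_both {N : ℕ} (hN : 1 ≤ N) (z y : EuclideanSpace ℝ (Fin N)) (d σ ρ : ℝ)
    (hρ : 0 < ρ ∨ (ρ = 0 ∧ σ = 1)) (hσ : σ ^ 2 = 1) :
    ∃ M δ1 : ℝ, 0 ≤ M ∧ 0 < δ1 ∧ ∀ δ, 0 < δ → δ < δ1 → ∃ rm, 0 ≤ rm ∧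
      (∀ x ∈ ball y d, δ ≤ σ * (‖x - z‖ ^ 2 - ρ ^ 2) → σ * (‖x - z‖ ^ 2 - ρ ^ 2) ≤ 2 * δ →
        ‖x - z‖ ≤ rm) ∧
      rm * volume.real {x : EuclideanSpace ℝ (Fin N) | x ∈ ball y d ∧
        δ ≤ σ * (‖x - z‖ ^ 2 - ρ ^ 2) ∧ σ * (‖x - z‖ ^ 2 - ρ ^ 2) ≤ 2 * δ} ≤ M * δ := by
  rcases hρ with h | ⟨rfl, rfl⟩
  · exact vol_pos z y d σ ρ h hσ
  · exact vol_zero hN z y d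

lemma g_strictMono {g : ℝ → ℝ} (hg : GCond g) : StrictMonoOn g (Ici 0) := by
  apply strictMonoOn_of_deriv_pos (convex_Ici 0) hg.1
  intro x hx
  rw [interior_Ici] at hx
  exact hg.2.2.2 x hx

lemma g_nonneg {g : ℝ → ℝ} (hg : GCond g) {t : ℝ} (ht : 0 ≤ t) : 0 ≤ g t := by
  have := (g_strictMono hg).monotoneOn (mem_Ici.2 le_rfl) (mem_Ici.2 ht) ht
  rwa [hg.2.2.1] at this

lemma ann_grad {N : ℕ} {u : EuclideanSpace ℝ (Fin N) → ℝ} {z : EuclideanSpace ℝ (Fin N)}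
    {ri ro : ℝ} {U U' : ℝ → ℝ} (hri : 0 ≤ ri) (hU : C1On U U' ri ro)
    (hu : ∀ x ∈ ball z ro \ closedBall z ri, u x = U ‖x - z‖)
    {x : EuclideanSpace ℝ (Fin N)} (hx : x ∈ ball z ro \ closedBall z ri) :
    gradient u x = (U' ‖x - z‖ / ‖x - z‖) • (x - z) := by
  have hx1 : ‖x - z‖ < ro := by simpa [dist_eq_norm] using hx.1
  have hx2 : ri < ‖x - z‖ := by simpa [dist_eq_norm] using hx.2
  have hpos : 0 < ‖x - z‖ := lt_of_le_of_lt hri hx2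
  apply HasGradientAt.gradient
  rw [hasGradientAt_iff_hasFDerivAt]
  have hz : HasFDerivAt (fun x : EuclideanSpace ℝ (Fin N) => ‖x - z‖ ^ 2) _ x :=
    ((hasFDerivAt_id x).sub_const z).norm_sq
  have hs := hz.sqrt (by positivity)
  have hs' : HasFDerivAt (fun x : EuclideanSpace ℝ (Fin N) => ‖x - z‖) _ x :=
    hs.congr_of_eventuallyEq (Filter.Eventually.of_forall fun y => by
      simp [Real.sqrt_sq (norm_nonneg _)])
  have hd : HasDerivAt U (U' ‖x - z‖) ‖x - z‖ :=
    (hU.2 _ ⟨hx2.le, hx1.le⟩).hasDerivAt (Icc_mem_nhds hx2 hx1)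
  have hc := hd.comp_hasFDerivAt x hs'
  have hop : IsOpen (ball z ro \ closedBall z ri) := isOpen_ball.sdiff isClosed_closedBall
  refine (hc.congr_fderiv ?_).congr_of_eventuallyEq ?_
  · ext v
    simp [InnerProductSpace.toDual_apply_apply, inner_smul_left, Real.sqrt_sq (norm_nonneg _)]
    field_simp
  · filter_upwards [hop.mem_nhds hx] with y hy
    exact hu y hy

lemma ann_gvec {N : ℕ} {g : ℝ → ℝ} (hg : GCond g) {x z : EuclideanSpace ℝ (Fin N)} {s : ℝ}
    (hs : s < 0) (hx : 0 < ‖x - z‖) :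
    gvec g ((s / ‖x - z‖) • (x - z)) = -(g |s| / ‖x - z‖) • (x - z) := by
  have hne : x - z ≠ 0 := norm_pos_iff.1 hx
  have h1 : (s / ‖x - z‖) • (x - z) ≠ 0 := smul_ne_zero (div_ne_zero hs.ne hx.ne') hne
  have h2 : ‖(s / ‖x - z‖) • (x - z)‖ = |s| := by
    rw [norm_smul, norm_div, norm_norm, Real.norm_eq_abs]; field_simp
  unfold gvec
  rw [if_neg h1, h2, smul_smul, abs_of_neg hs]
  congr 1
  have := hs.ne
  field_simp

lemma ann_flux {N : ℕ} (hN : 1 ≤ N) {R : ℝ} {g : ℝ → ℝ} {f : ℝ → ℝ → ℝ}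
    {u : EuclideanSpace ℝ (Fin N) → ℝ} (hg : GCond g)
    (hdist : IsDistribSolBall R g f u)
    (hcont : ContinuousOn (fun x => f ‖x‖ (u x)) (ball (0 : EuclideanSpace ℝ (Fin N)) R))
    {z : EuclideanSpace ℝ (Fin N)} {ri ro : ℝ} {U U' : ℝ → ℝ} (hri : 0 ≤ ri)
    (hU : C1On U U' ri ro)
    (hu : ∀ x ∈ ball z ro \ closedBall z ri, u x = U ‖x - z‖)
    (hneg : ∀ r ∈ Ioo ri ro, U' r < 0)
    {ρ σ : ℝ} (hρI : ρ ∈ Icc ri ro) (hσ : σ ^ 2 = 1) (hρ : 0 < ρ ∨ (ρ = 0 ∧ σ = 1))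
    (hU'ρ : U' ρ = 0) {y : EuclideanSpace ℝ (Fin N)} {d c : ℝ} (hd : 0 < d) (hc : 0 < c)
    (hD : closedBall y d ⊆ ball (0 : EuclideanSpace ℝ (Fin N)) R)
    (hA : ∀ x ∈ ball y d, 0 < σ * (‖x - z‖ ^ 2 - ρ ^ 2) → x ∈ ball z ro \ closedBall z ri)
    (hin : ∀ x ∈ ball y d, 0 < σ * (‖x - z‖ ^ 2 - ρ ^ 2) → 0 ≤ σ * ⟪x - z, x - y⟫)
    (hh : ∀ x ∈ ball y d, σ * f ‖x‖ (u x) ≤ -c)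
    (hne : ∃ x ∈ ball y d, 0 < σ * (‖x - z‖ ^ 2 - ρ ^ 2)) : False := by
  obtain ⟨M, δ1, hM, hδ1, hvol⟩ := vol_both hN z y d σ ρ hρ hσ
  have hρ0 : 0 ≤ ρ := hri.trans hρI.1
  have hfacts : ∀ x ∈ ball y d, 0 < σ * (‖x - z‖ ^ 2 - ρ ^ 2) →
      ‖x - z‖ ∈ Ioo ri ro ∧ 0 < ‖x - z‖ := by
    intro x hx hp
    have h := hA x hx hp
    have hx1 : ‖x - z‖ < ro := by simpa [dist_eq_norm] using h.1
    have hx2 : ri < ‖x - z‖ := by simpa [dist_eq_norm] using h.2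
    exact ⟨⟨hx2, hx1⟩, lt_of_le_of_lt hri hx2⟩
  refine flux hdist hcont z y d σ (ρ ^ 2) c M δ1 hd hD
    (fun x => g |U' ‖x - z‖| / ‖x - z‖) ?_ ?_ ?_ ?_ hσ hc (fun x hx _ => hh x hx) hM hδ1 hvol hne
  · intro x hx hp
    obtain ⟨h1, h2⟩ := hfacts x hx hp
    rw [ann_grad hri hU hu (hA x hx hp), ann_gvec hg (hneg _ h1) h2]
  · intro x hx hp
    exact div_nonneg (g_nonneg hg (abs_nonneg _)) (norm_nonneg _)
  · intro x hx hp
    exact mul_nonneg (div_nonneg (g_nonneg hg (abs_nonneg _)) (norm_nonneg _)) (hin x hx hp)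
  · intro ε hε
    have hcw : ContinuousWithinAt (fun r => g |U' r|) (Icc ri ro) ρ := by
      have h1 : ContinuousWithinAt (fun r => |U' r|) (Icc ri ro) ρ := (hU.1 ρ hρI).abs
      exact ContinuousWithinAt.comp (t := Ici 0) (hg.1 _ (mem_Ici.2 (abs_nonneg _))) h1
        (fun r _ => mem_Ici.2 (abs_nonneg _))
    rw [Metric.continuousWithinAt_iff] at hcw
    obtain ⟨η, hη, hcl⟩ := hcw ε hε
    refine ⟨η ^ 2, by positivity, fun x hx hp hlt => ?_⟩
    obtain ⟨h1, h2⟩ := hfacts x hx hp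
    rw [div_mul_cancel₀ _ h2.ne']
    have hab : |‖x - z‖ ^ 2 - ρ ^ 2| < η ^ 2 := by
      rcases sq_eq_one_iff_cases hσ with h | h <;> rw [h] at hp hlt <;>
      rw [abs_lt] <;> constructor <;> linarith
    have e : |‖x - z‖ ^ 2 - ρ ^ 2| = |‖x - z‖ - ρ| * (‖x - z‖ + ρ) := by
      rw [sq_sub_sq, abs_mul, abs_of_nonneg (by positivity : 0 ≤ ‖x - z‖ + ρ), mul_comm]
    have hle : |‖x - z‖ - ρ| ≤ ‖x - z‖ + ρ := by rw [abs_le]; constructor <;> linarith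
    have hlt2 : |‖x - z‖ - ρ| < η := by
      by_contra hcon
      push Not at hcon
      nlinarith [abs_nonneg (‖x - z‖ - ρ)]
    have := hcl (Ioo_subset_Icc_self h1) (by rwa [Real.dist_eq])
    rw [hU'ρ, abs_zero, hg.2.2.1, Real.dist_eq, sub_zero] at this
    exact (le_abs_self _).trans this.le

lemma nonconst {N : ℕ} {R : ℝ} {g : ℝ → ℝ} {f : ℝ → ℝ → ℝ}
    {u : EuclideanSpace ℝ (Fin N) → ℝ}
    (hdist : IsDistribSolBall R g f u)
    (hcont : ContinuousOn (fun x => f ‖x‖ (u x)) (ball (0 : EuclideanSpace ℝ (Fin N)) R))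
    {W : Set (EuclideanSpace ℝ (Fin N))} (hW : IsOpen W)
    (hWR : W ⊆ ball (0 : EuclideanSpace ℝ (Fin N)) R) {p : EuclideanSpace ℝ (Fin N)}
    (hp : p ∈ W) (hpf : f ‖p‖ (u p) ≠ 0) : ∃ p' ∈ W, gradient u p' ≠ 0 := by
  by_contra hcon
  push Not at hcon
  obtain ⟨σ, hσ, hσf⟩ : ∃ σ : ℝ, σ ^ 2 = 1 ∧ σ * f ‖p‖ (u p) = -|f ‖p‖ (u p)| := by
    rcases lt_or_gt_of_ne hpf with h | h
    · exact ⟨1, by norm_num, by rw [abs_of_neg h]; ring⟩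
    · exact ⟨-1, by norm_num, by rw [abs_of_pos h]; ring⟩
  have hca : ContinuousAt (fun x => σ * f ‖x‖ (u x)) p :=
    (hcont.continuousAt (isOpen_ball.mem_nhds (hWR hp))).const_mul σ
  have hc : 0 < |f ‖p‖ (u p)| := abs_pos.2 hpf
  have hev : ∀ᶠ x in nhds p, x ∈ W ∧ σ * f ‖x‖ (u x) < -(|f ‖p‖ (u p)| / 2) := by
    refine (hW.eventually_mem hp).and (hca.eventually_lt_const ?_)
    show σ * f ‖p‖ (u p) < _
    rw [hσf]; linarith
  obtain ⟨d', hd', hball⟩ := Metric.eventually_nhds_iff_ball.1 hev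
  have hD : closedBall p (d' / 2) ⊆ ball p d' := closedBall_subset_ball (by linarith)
  have hge : ∀ x : EuclideanSpace ℝ (Fin N), x ∈ ball p (d' / 2) →
      1 ≤ σ * (‖x - p‖ ^ 2 - -(σ * ((d' / 2) ^ 2 + 1))) := by
    intro x hx
    rw [mem_ball, dist_eq_norm] at hx
    have e : σ * (‖x - p‖ ^ 2 - -(σ * ((d' / 2) ^ 2 + 1))) =
      σ * ‖x - p‖ ^ 2 + σ ^ 2 * ((d' / 2) ^ 2 + 1) := by ring
    rw [e, hσ]
    have h1 : ‖x - p‖ ^ 2 ≤ (d' / 2) ^ 2 := by gcongr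
    rcases sq_eq_one_iff_cases hσ with h | h <;> rw [h] <;> nlinarith [sq_nonneg ‖x - p‖]
  refine flux hdist hcont p p (d' / 2) σ (-(σ * ((d' / 2) ^ 2 + 1))) (|f ‖p‖ (u p)| / 2) 0 (1 / 2)
    (by positivity) (fun x hx => hWR (hball x (hD hx)).1) (fun _ => 0) ?_ ?_ ?_ ?_ hσ (by positivity)
    ?_ le_rfl (by norm_num) ?_ ?_
  · intro x hx _
    rw [hcon x (hball x (hD (ball_subset_closedBall hx))).1]
    simp [gvec]
  · simp
  · simp
  · intro ε hε
    refine ⟨1, one_pos, fun x _ _ _ => ?_⟩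
    simpa using hε.le
  · intro x hx _
    exact (hball x (hD (ball_subset_closedBall hx))).2.le
  · intro δ hδ hδ1
    refine ⟨0, le_rfl, fun x hx _ h2 => ?_, by simp⟩
    have := hge x hx
    linarith
  · exact ⟨p, mem_ball_self (by positivity), lt_of_lt_of_le one_pos (hge p (mem_ball_self (by positivity)))⟩

lemma exists_unit_dir {N : ℕ} (hN : 1 ≤ N) (q z : EuclideanSpace ℝ (Fin N)) :
    ∃ ν : EuclideanSpace ℝ (Fin N), ‖ν‖ = 1 ∧ q = z + ‖q - z‖ • ν := by
  by_cases h : q = z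
  · have : Nonempty (Fin N) := ⟨⟨0, hN⟩⟩
    obtain ⟨ν, hν⟩ := exists_norm_eq (EuclideanSpace ℝ (Fin N)) (zero_le_one (α := ℝ))
    exact ⟨ν, hν, by simp [h]⟩
  · have hpos : ‖q - z‖ ≠ 0 := norm_ne_zero_iff.2 (sub_ne_zero.2 h)
    refine ⟨(‖q - z‖⁻¹) • (q - z), ?_, ?_⟩
    · rw [norm_smul, norm_inv, norm_norm, inv_mul_cancel₀ hpos]
    · rw [smul_smul, mul_inv_cancel₀ hpos, one_smul]; abel

lemma ann_inner {N : ℕ} (hN : 1 ≤ N) {R : ℝ} {g : ℝ → ℝ} {f : ℝ → ℝ → ℝ}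
    {u : EuclideanSpace ℝ (Fin N) → ℝ} (hg : GCond g)
    (hdist : IsDistribSolBall R g f u)
    (hcont : ContinuousOn (fun x => f ‖x‖ (u x)) (ball (0 : EuclideanSpace ℝ (Fin N)) R))
    {z : EuclideanSpace ℝ (Fin N)} {ri ro : ℝ} {U U' : ℝ → ℝ} (hri : 0 ≤ ri) (hro : ri < ro)
    (hU : C1On U U' ri ro)
    (hu : ∀ x ∈ ball z ro \ closedBall z ri, u x = U ‖x - z‖)
    (hneg : ∀ r ∈ Ioo ri ro, U' r < 0) (hU' : U' ri = 0)
    {q : EuclideanSpace ℝ (Fin N)} (hq : q ∈ ball (0 : EuclideanSpace ℝ (Fin N)) R)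
    (hqz : ‖q - z‖ = ri) : 0 ≤ f ‖q‖ (u q) := by
  by_contra hcon
  push Not at hcon
  have hca : ContinuousAt (fun x => f ‖x‖ (u x)) q := hcont.continuousAt (isOpen_ball.mem_nhds hq)
  have hev : ∀ᶠ x in nhds q, x ∈ ball (0 : EuclideanSpace ℝ (Fin N)) R ∧
      f ‖x‖ (u x) < f ‖q‖ (u q) / 2 := by
    refine (isOpen_ball.eventually_mem hq).and (hca.eventually_lt_const ?_)
    show f ‖q‖ (u q) < _
    linarith
  obtain ⟨d', hd', hball⟩ := Metric.eventually_nhds_iff_ball.1 hev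
  obtain ⟨ν, hν, hqν⟩ := exists_unit_dir hN q z
  rw [hqz] at hqν
  set d := min (d' / 2) (ro - ri) with hd
  have hd0 : 0 < d := lt_min (by linarith) (by linarith)
  have hd1 : d ≤ d' / 2 := min_le_left _ _
  have hd2 : d ≤ ro - ri := min_le_right _ _
  have hcb : closedBall q d ⊆ ball q d' := closedBall_subset_ball (by linarith)
  have hpos : ∀ x : EuclideanSpace ℝ (Fin N), 0 < 1 * (‖x - z‖ ^ 2 - ri ^ 2) → ri < ‖x - z‖ := by
    intro x hx
    by_contra hle
    push Not at hle
    nlinarith [norm_nonneg (x - z)]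
  refine ann_flux hN hg hdist hcont hri hU hu hneg (ρ := ri) (σ := 1) (y := q) (d := d)
    (c := -(f ‖q‖ (u q) / 2)) ⟨le_rfl, hro.le⟩ (by norm_num) ?_ hU' hd0 (by linarith)
    (fun x hx => (hball x (hcb hx)).1) ?_ ?_ ?_ ?_
  · rcases hri.lt_or_eq with h | h
    · exact Or.inl h
    · exact Or.inr ⟨h.symm, rfl⟩
  · intro x hx hp
    have h1 := hpos x hp
    rw [mem_ball, dist_eq_norm] at hx
    have h2 : ‖x - z‖ ≤ ‖x - q‖ + ‖q - z‖ := norm_sub_le_norm_sub_add_norm_sub x q z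
    simp only [mem_diff, mem_ball, mem_closedBall, dist_eq_norm]
    constructor <;> linarith
  · intro x hx hp
    have h1 := hpos x hp
    have e : x - q = (x - z) - (q - z) := by abel
    rw [one_mul, e, inner_sub_right, real_inner_self_eq_norm_sq]
    have h2 : ⟪x - z, q - z⟫ ≤ ‖x - z‖ * ‖q - z‖ := real_inner_le_norm _ _
    rw [hqz] at h2
    nlinarith [norm_nonneg (x - z)]
  · intro x hx
    have := (hball x (hcb (ball_subset_closedBall hx))).2
    linarith
  · refine ⟨q + (d / 2) • ν, ?_, ?_⟩
    · rw [mem_ball, dist_eq_norm, add_sub_cancel_left, norm_smul, hν, Real.norm_eq_abs,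
        abs_of_pos (by positivity)]
      linarith
    · have e : q + (d / 2) • ν - z = (ri + d / 2) • ν := by rw [hqν, add_smul]; abel
      rw [e, norm_smul, hν, Real.norm_eq_abs, abs_of_pos (by positivity)]
      nlinarith

lemma ann_outer {N : ℕ} (hN : 1 ≤ N) {R : ℝ} {g : ℝ → ℝ} {f : ℝ → ℝ → ℝ}
    {u : EuclideanSpace ℝ (Fin N) → ℝ} (hg : GCond g)
    (hdist : IsDistribSolBall R g f u)
    (hcont : ContinuousOn (fun x => f ‖x‖ (u x)) (ball (0 : EuclideanSpace ℝ (Fin N)) R))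
    {z : EuclideanSpace ℝ (Fin N)} {ri ro : ℝ} {U U' : ℝ → ℝ} (hri : 0 ≤ ri) (hro : ri < ro)
    (hU : C1On U U' ri ro)
    (hu : ∀ x ∈ ball z ro \ closedBall z ri, u x = U ‖x - z‖)
    (hneg : ∀ r ∈ Ioo ri ro, U' r < 0) (hU' : U' ro = 0)
    {q : EuclideanSpace ℝ (Fin N)} (hq : q ∈ ball (0 : EuclideanSpace ℝ (Fin N)) R)
    (hqz : ‖q - z‖ = ro) : f ‖q‖ (u q) ≤ 0 := by
  by_contra hcon
  push Not at hcon
  have hro0 : 0 < ro := lt_of_le_of_lt hri hro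
  have hca : ContinuousAt (fun x => f ‖x‖ (u x)) q := hcont.continuousAt (isOpen_ball.mem_nhds hq)
  have hev : ∀ᶠ x in nhds q, x ∈ ball (0 : EuclideanSpace ℝ (Fin N)) R ∧
      f ‖q‖ (u q) / 2 < f ‖x‖ (u x) := by
    refine (isOpen_ball.eventually_mem hq).and (hca.eventually_const_lt ?_)
    show _ < f ‖q‖ (u q)
    linarith
  obtain ⟨d', hd', hball⟩ := Metric.eventually_nhds_iff_ball.1 hev
  obtain ⟨ν, hν, hqν⟩ := exists_unit_dir hN q z
  rw [hqz] at hqν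
  set d := min d' (ro - ri) / 3 with hd
  have hd0 : 0 < d := by
    have : 0 < min d' (ro - ri) := lt_min hd' (by linarith)
    positivity
  have hd1 : d ≤ d' / 3 := by rw [hd]; gcongr; exact min_le_left _ _
  have hd2 : d ≤ (ro - ri) / 3 := by rw [hd]; gcongr; exact min_le_right _ _
  set t := √(ro ^ 2 + d ^ 2) - ro with ht
  have hsq : (ro + t) ^ 2 = ro ^ 2 + d ^ 2 := by
    rw [ht, add_sub_cancel, Real.sq_sqrt (by positivity)]
  have hrt : 0 ≤ ro + t := by rw [ht, add_sub_cancel]; positivity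
  have ht0 : 0 < t := by
    by_contra h
    push Not at h
    nlinarith
  have htd : t < d := by
    by_contra h
    push Not at h
    nlinarith
  set y := z + (ro + t) • ν with hy
  have hyq : ‖y - q‖ = t := by
    have : y - q = t • ν := by rw [hy, hqν, add_smul]; abel
    rw [this, norm_smul, hν, Real.norm_eq_abs, abs_of_pos ht0, mul_one]
  have hyz : ‖y - z‖ = ro + t := by
    have : y - z = (ro + t) • ν := by rw [hy]; abel
    rw [this, norm_smul, hν, Real.norm_eq_abs, abs_of_nonneg hrt, mul_one]
  have hcb : closedBall y d ⊆ ball q d' := by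
    intro x hx
    rw [mem_closedBall, dist_eq_norm] at hx
    rw [mem_ball, dist_eq_norm]
    have := norm_sub_le_norm_sub_add_norm_sub x y q
    linarith
  have hlt : ∀ x : EuclideanSpace ℝ (Fin N), 0 < -1 * (‖x - z‖ ^ 2 - ro ^ 2) → ‖x - z‖ < ro := by
    intro x hx
    by_contra hle
    push Not at hle
    nlinarith [norm_nonneg (x - z)]
  refine ann_flux hN hg hdist hcont hri hU hu hneg (ρ := ro) (σ := -1) (y := y) (d := d)
    (c := f ‖q‖ (u q) / 2) ⟨hro.le, le_rfl⟩ (by norm_num) (Or.inl hro0) hU' hd0 (by linarith)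
    (fun x hx => (hball x (hcb hx)).1) ?_ ?_ ?_ ?_
  · intro x hx hp
    have h1 := hlt x hp
    rw [mem_ball, dist_eq_norm] at hx
    have h2 : ‖y - z‖ ≤ ‖y - x‖ + ‖x - z‖ := norm_sub_le_norm_sub_add_norm_sub y x z
    rw [norm_sub_rev y x] at h2
    simp only [mem_diff, mem_ball, mem_closedBall, dist_eq_norm]
    constructor <;> linarith
  · intro x hx hp
    have h1 := hlt x hp
    rw [mem_ball, dist_eq_norm] at hx
    have e : x - y = (x - z) - (y - z) := by abel
    have h3 : ‖x - y‖ ^ 2 < d ^ 2 := by gcongr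
    rw [e, norm_sub_sq_real, hyz, hsq] at h3
    rw [e, inner_sub_right, real_inner_self_eq_norm_sq]
    nlinarith [norm_nonneg (x - z)]
  · intro x hx
    have := (hball x (hcb (ball_subset_closedBall hx))).2
    linarith
  · refine ⟨z + (ro - (d - t) / 2) • ν, ?_, ?_⟩
    · have e : z + (ro - (d - t) / 2) • ν - y = (-((d + t) / 2)) • ν := by
        rw [hy]; module
      rw [mem_ball, dist_eq_norm, e, norm_smul, hν, Real.norm_eq_abs, abs_neg,
        abs_of_pos (by positivity)]
      linarith
    · rw [add_sub_cancel_left, norm_smul, hν, Real.norm_eq_abs, abs_of_pos (by linarith)]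
      nlinarith

lemma finite_balls {N : ℕ} {R : ℝ} {K : Set ℕ} {A : ℕ → Set (EuclideanSpace ℝ (Fin N))}
    (hdisj : K.PairwiseDisjoint A) (hopen : ∀ k ∈ K, IsOpen (A k))
    (hsub : ∀ k ∈ K, A k ⊆ ball (0 : EuclideanSpace ℝ (Fin N)) R) {δ : ℝ} (hδ : 0 < δ) :
    {j | j ∈ K ∧ ∃ c, ball c δ ⊆ A j}.Finite := by
  have hfin := Measure.finite_const_le_meas_of_disjoint_iUnion (ι := K)
    (volume : Measure (EuclideanSpace ℝ (Fin N)))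
    (ε := volume (ball (0 : EuclideanSpace ℝ (Fin N)) δ)) (measure_ball_pos _ _ hδ)
    (As := fun k : K => A k) (fun k => (hopen k k.2).measurableSet)
    (fun i j hij => hdisj i.2 j.2 (fun h => hij (Subtype.ext h)))
    (((measure_mono (iUnion_subset fun k : K => hsub k k.2)).trans_lt measure_ball_lt_top).ne)
  refine (hfin.image Subtype.val).subset ?_
  rintro j ⟨hj, c, hc⟩
  refine ⟨⟨j, hj⟩, ?_, rfl⟩
  show volume (ball (0 : EuclideanSpace ℝ (Fin N)) δ) ≤ volume (A j)
  rw [← Measure.addHaar_ball_center _ c]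
  exact measure_mono hc


lemma contAt_gradient {N : ℕ} {R : ℝ} {u : EuclideanSpace ℝ (Fin N) → ℝ}
    (hu : ContDiffOn ℝ 1 u (closedBall 0 R)) {q : EuclideanSpace ℝ (Fin N)}
    (hq : q ∈ ball (0 : EuclideanSpace ℝ (Fin N)) R) : ContinuousAt (gradient u) q := by
  have h1 : ContDiffOn ℝ 1 u (ball 0 R) := hu.mono ball_subset_closedBall
  have h2 := (h1.continuousOn_fderiv_of_isOpen isOpen_ball le_rfl).continuousAt
    (isOpen_ball.mem_nhds hq)
  exact (InnerProductSpace.toDual ℝ (EuclideanSpace ℝ (Fin N))).symm.continuous.continuousAt.comp h2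

lemma ann_mem_dir {N : ℕ} {z ν : EuclideanSpace ℝ (Fin N)} (hν : ‖ν‖ = 1) {ri ro r : ℝ}
    (hri : 0 ≤ ri) (hr : r ∈ Ioo ri ro) : z + r • ν ∈ ball z ro \ closedBall z ri := by
  have h : 0 ≤ r := hri.trans hr.1.le
  simp only [mem_sdiff, mem_ball, mem_closedBall, dist_eq_norm, add_sub_cancel_left, norm_smul, hν,
    Real.norm_eq_abs, abs_of_nonneg h, mul_one, not_le]
  exact ⟨hr.2, hr.1⟩

lemma ann_closure_dir {N : ℕ} {z ν : EuclideanSpace ℝ (Fin N)} (hν : ‖ν‖ = 1) {ri ro r : ℝ}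
    (hri : 0 ≤ ri) (hro : ri < ro) (hr : r ∈ Icc ri ro) :
    z + r • ν ∈ closure (ball z ro \ closedBall z ri) := by
  have hc : Continuous fun r : ℝ => z + r • ν := by fun_prop
  have h1 : r ∈ closure (Ioo ri ro) := by rwa [closure_Ioo hro.ne]
  exact map_mem_closure (f := fun r : ℝ => z + r • ν) hc h1 (fun s hs => ann_mem_dir hν hri hs)

lemma ann_closure_sub {N : ℕ} {z : EuclideanSpace ℝ (Fin N)} {ri ro : ℝ} :
    closure (ball z ro \ closedBall z ri) ⊆ closedBall z ro \ ball z ri := by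
  apply closure_minimal
  · exact sdiff_subset_sdiff ball_subset_closedBall ball_subset_closedBall
  · exact isClosed_closedBall.sdiff isOpen_ball

lemma ann_bdry_deriv {N : ℕ} (hN : 1 ≤ N) {u : EuclideanSpace ℝ (Fin N) → ℝ}
    {z q : EuclideanSpace ℝ (Fin N)} {ri ro : ℝ} {U U' : ℝ → ℝ} (hri : 0 ≤ ri) (hro : ri < ro)
    (hU : C1On U U' ri ro)
    (hu : ∀ x ∈ ball z ro \ closedBall z ri, u x = U ‖x - z‖)
    (hg0 : gradient u q = 0) (hgc : ContinuousAt (gradient u) q) (huc : ContinuousAt u q)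
    (hq : ‖q - z‖ ∈ Icc ri ro) : U' ‖q - z‖ = 0 ∧ u q = U ‖q - z‖ := by
  obtain ⟨ν, hν, hqν⟩ := exists_unit_dir hN q z
  set ρ := ‖q - z‖ with hρ
  have h1 : ρ ∈ closure (Ioo ri ro) := by rwa [closure_Ioo hro.ne]
  have : (nhdsWithin ρ (Ioo ri ro)).NeBot := mem_closure_iff_nhdsWithin_neBot.1 h1
  have hc : Continuous fun r : ℝ => z + r • ν := by fun_prop
  have ht : Filter.Tendsto (fun r : ℝ => z + r • ν) (nhdsWithin ρ (Ioo ri ro)) (nhds q) := by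
    have := (hc.tendsto ρ).mono_left (nhdsWithin_le_nhds (s := Ioo ri ro))
    rwa [← hqν] at this
  have hnorm : ∀ r ∈ Ioo ri ro, ‖z + r • ν - z‖ = r := by
    intro r hr
    rw [add_sub_cancel_left, norm_smul, hν, Real.norm_eq_abs, abs_of_nonneg (hri.trans hr.1.le),
      mul_one]
  constructor
  · have t1 : Filter.Tendsto (fun r : ℝ => ‖gradient u (z + r • ν)‖)
        (nhdsWithin ρ (Ioo ri ro)) (nhds ‖gradient u q‖) := (hgc.tendsto.comp ht).norm
    have t2 : Filter.Tendsto (fun r : ℝ => |U' r|)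
        (nhdsWithin ρ (Ioo ri ro)) (nhds |U' ρ|) :=
      ((hU.1 ρ hq).mono Ioo_subset_Icc_self).tendsto.abs
    have heq : (fun r : ℝ => ‖gradient u (z + r • ν)‖) =ᶠ[nhdsWithin ρ (Ioo ri ro)]
        fun r => |U' r| := by
      filter_upwards [self_mem_nhdsWithin] with r hr
      have hr0 : 0 < r := lt_of_le_of_lt hri hr.1
      rw [ann_grad hri hU hu (ann_mem_dir hν hri hr), norm_smul, hnorm r hr, Real.norm_eq_abs,
        abs_div, abs_of_pos hr0]
      field_simp
    have := tendsto_nhds_unique (t1.congr' heq) t2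
    rw [hg0, norm_zero] at this
    exact abs_eq_zero.1 this.symm
  · have t1 : Filter.Tendsto (fun r : ℝ => u (z + r • ν))
        (nhdsWithin ρ (Ioo ri ro)) (nhds (u q)) := huc.tendsto.comp ht
    have t2 : Filter.Tendsto U (nhdsWithin ρ (Ioo ri ro)) (nhds (U ρ)) :=
      ((hU.2 ρ hq).continuousWithinAt.mono Ioo_subset_Icc_self).tendsto
    have heq : (fun r : ℝ => u (z + r • ν)) =ᶠ[nhdsWithin ρ (Ioo ri ro)] U := by
      filter_upwards [self_mem_nhdsWithin] with r hr
      rw [hu _ (ann_mem_dir hν hri hr), hnorm r hr]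
    exact tendsto_nhds_unique (t1.congr' heq) t2

lemma ann_strictAnti {ri ro : ℝ} {U U' : ℝ → ℝ} (hU : C1On U U' ri ro)
    (hneg : ∀ r ∈ Ioo ri ro, U' r < 0) : StrictAntiOn U (Icc ri ro) := by
  apply strictAntiOn_of_hasDerivWithinAt_neg (f' := U') (convex_Icc _ _)
    (fun r hr => (hU.2 r hr).continuousWithinAt)
  · intro r hr
    rw [interior_Icc] at hr ⊢
    exact (hU.2 r (Ioo_subset_Icc_self hr)).mono Ioo_subset_Icc_self
  · intro r hr
    rw [interior_Icc] at hr
    exact hneg r hr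

/-- Two balls touching at `x`, with interiors (near `x`) disjoint, are externally tangent. -/
lemma tangent_balls {N : ℕ} {x a b : EuclideanSpace ℝ (Fin N)} {ra rb Ra Rb : ℝ}
    (ha0 : 0 ≤ ra) (ha : ra < Ra) (hb0 : 0 ≤ rb) (hb : rb < Rb)
    (hxa : ‖x - a‖ = Ra) (hxb : ‖x - b‖ = Rb)
    (hdis : Disjoint (ball a Ra \ closedBall a ra) (ball b Rb \ closedBall b rb)) :
    Rb • (x - a) = -(Ra • (x - b)) := by
  by_contra hne
  have hRa : 0 < Ra := lt_of_le_of_lt ha0 ha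
  have hRb : 0 < Rb := lt_of_le_of_lt hb0 hb
  set v := Rb • (x - a) + Ra • (x - b) with hv
  have hv0 : v ≠ 0 := fun h => hne (eq_neg_of_add_eq_zero_left h)
  have hvpos : 0 < ‖v‖ ^ 2 := by positivity
  have hexp : ‖v‖ ^ 2 = 2 * Ra * Rb * (Ra * Rb + ⟪x - a, x - b⟫) := by
    rw [hv, norm_add_sq_real, norm_smul, norm_smul, real_inner_smul_left, real_inner_smul_right,
      hxa, hxb, Real.norm_eq_abs, Real.norm_eq_abs, abs_of_pos hRa, abs_of_pos hRb]
    ring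
  have hI : 0 < Ra * Rb + ⟪x - a, x - b⟫ := by
    rw [hexp] at hvpos
    exact (mul_pos_iff_of_pos_left (by positivity)).1 hvpos
  have ia : 0 < ⟪x - a, v⟫ := by
    rw [hv, inner_add_right, real_inner_smul_right, real_inner_smul_right,
      real_inner_self_eq_norm_sq, hxa]
    nlinarith
  have ib : 0 < ⟪x - b, v⟫ := by
    rw [hv, inner_add_right, real_inner_smul_right, real_inner_smul_right,
      real_inner_self_eq_norm_sq, hxb, real_inner_comm]
    nlinarith
  have key : ∀ (c : EuclideanSpace ℝ (Fin N)) (rc Rc : ℝ), 0 ≤ rc → rc < Rc → ‖x - c‖ = Rc →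
      0 < ⟪x - c, v⟫ → ∀ᶠ s in nhdsWithin (0 : ℝ) (Ioi 0), x - s • v ∈ ball c Rc \ closedBall c rc := by
    intro c rc Rc hc0 hc hxc hi
    have hcont : Continuous fun s : ℝ => ‖x - s • v - c‖ := by fun_prop
    have e1 : ∀ᶠ s in nhdsWithin (0 : ℝ) (Ioi 0), rc < ‖x - s • v - c‖ := by
      refine (hcont.continuousAt.eventually_const_lt ?_).filter_mono nhdsWithin_le_nhds
      simpa [hxc] using hc
    have hcont2 : Continuous fun s : ℝ => s * ‖v‖ ^ 2 := by fun_prop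
    have e2 : ∀ᶠ s in nhdsWithin (0 : ℝ) (Ioi 0), s * ‖v‖ ^ 2 < 2 * ⟪x - c, v⟫ := by
      refine (hcont2.continuousAt.eventually_lt_const ?_).filter_mono nhdsWithin_le_nhds
      simpa using hi
    filter_upwards [e1, e2, self_mem_nhdsWithin] with s h1 h2 h3
    simp only [mem_sdiff, mem_ball, mem_closedBall, dist_eq_norm, not_le]
    refine ⟨?_, h1⟩
    have h3' : (0:ℝ) < s := h3
    have e : x - s • v - c = (x - c) - s • v := by abel
    have : ‖x - s • v - c‖ ^ 2 < Rc ^ 2 := by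
      rw [e, norm_sub_sq_real, real_inner_smul_right, norm_smul, hxc, mul_pow, Real.norm_eq_abs,
        sq_abs]
      nlinarith
    exact lt_of_pow_lt_pow_left₀ 2 (by linarith) this
  obtain ⟨s, h1, h2⟩ := ((key a ra Ra ha0 ha hxa ia).and (key b rb Rb hb0 hb hxb ib)).exists
  exact Set.disjoint_left.1 hdis h1 h2

lemma exists_perp {N : ℕ} (hN : 2 ≤ N) (w : EuclideanSpace ℝ (Fin N)) :
    ∃ e : EuclideanSpace ℝ (Fin N), e ≠ 0 ∧ ⟪w, e⟫ = 0 := by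
  have h : (Submodule.span ℝ {w})ᗮ ≠ ⊥ := by
    intro h
    rw [Submodule.orthogonal_eq_bot_iff] at h
    have h1 := finrank_span_le_card (R := ℝ) ({w} : Set (EuclideanSpace ℝ (Fin N)))
    rw [h, finrank_top, finrank_euclideanSpace_fin] at h1
    simp at h1
    omega
  obtain ⟨e, he, he0⟩ := Submodule.exists_mem_ne_zero_of_ne_bot h
  exact ⟨e, he0, Submodule.mem_orthogonal_singleton_iff_inner_right.1 he⟩

lemma perp_norm_gt {N : ℕ} {w e : EuclideanSpace ℝ (Fin N)} (he : e ≠ 0) (hwe : ⟪w, e⟫ = 0)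
    {t : ℝ} (ht : 0 < t) : ‖w‖ < ‖w + t • e‖ := by
  have h : 0 < ‖t • e‖ := norm_pos_iff.2 (smul_ne_zero ht.ne' he)
  have : ‖w‖ ^ 2 < ‖w + t • e‖ ^ 2 := by
    rw [norm_add_sq_real, real_inner_smul_right, hwe]
    nlinarith
  exact lt_of_pow_lt_pow_left₀ 2 (norm_nonneg _) this


/-- Lemma 3.5: if `A = B_{ρ'}(z) \ clos B_ρ(z)` is one of the annuli in the local-symmetry
decomposition of a weak solution `u` of (P), and `x₀ ∈ ∂A ∩ B_R` with either
`x₀ ∈ ∂B_ρ(z)` and `ρ > 0`, or `x₀ ∈ ∂B_{ρ'}(z)` and `N ≥ 2`,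
then `f(|x₀|, u(x₀)) = 0`. -/
theorem f_vanishes_on_annulus_boundary
    {N : ℕ} (hN : 1 ≤ N) (R : ℝ) (hR : 0 < R) (g : ℝ → ℝ) (f : ℝ → ℝ → ℝ)
    (hg : GCond g) (hf : FCond R f)
    (u : EuclideanSpace ℝ (Fin N) → ℝ) (hu : IsWeakSolP R g f u)
    -- the data of a local-symmetry decomposition of `u`:
    (K : Set ℕ) (z : ℕ → EuclideanSpace ℝ (Fin N)) (ri ro : ℕ → ℝ) (U U' : ℕ → ℝ → ℝ)
    (hdata : ∀ k ∈ K, z k ∈ ball (0:EuclideanSpace ℝ (Fin N)) R ∧ 0 ≤ ri k ∧ ri k < ro k)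
    (hdisj : K.PairwiseDisjoint (fun k => ball (z k) (ro k) \ closedBall (z k) (ri k)))
    (hcover : ball (0:EuclideanSpace ℝ (Fin N)) R =
      (⋃ k ∈ K, ball (z k) (ro k) \ closedBall (z k) (ri k)) ∪
        {x ∈ ball (0:EuclideanSpace ℝ (Fin N)) R | gradient u x = 0})
    (hprof : ∀ k ∈ K,
      C1On (U k) (U' k) (ri k) (ro k) ∧
      (∀ x ∈ ball (z k) (ro k) \ closedBall (z k) (ri k), u x = U k ‖x - z k‖) ∧
      (∀ r ∈ Ioo (ri k) (ro k), U' k r < 0) ∧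
      (∀ x ∈ ball (z k) (ri k), U k (ri k) ≤ u x))
    -- a fixed annulus of the decomposition and a point of its relative boundary:
    (k : ℕ) (hk : k ∈ K) (hro : ro k < R)
    (x₀ : EuclideanSpace ℝ (Fin N)) (hx₀ : x₀ ∈ ball (0:EuclideanSpace ℝ (Fin N)) R)
    (hcase : (x₀ ∈ sphere (z k) (ri k) ∧ 0 < ri k) ∨ (x₀ ∈ sphere (z k) (ro k) ∧ 2 ≤ N)) :
    f ‖x₀‖ (u x₀) = 0 := by
  obtain ⟨huC, hupos, -, -, hdist⟩ := hu
  set A : ℕ → Set (EuclideanSpace ℝ (Fin N)) :=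
    fun j => ball (z j) (ro j) \ closedBall (z j) (ri j) with hA
  have hcont : ContinuousOn (fun x => f ‖x‖ (u x)) (ball (0 : EuclideanSpace ℝ (Fin N)) R) := by
    have h1 : ContinuousOn (fun x : EuclideanSpace ℝ (Fin N) => ((‖x‖, u x) : ℝ × ℝ))
        (ball (0 : EuclideanSpace ℝ (Fin N)) R) :=
      continuous_norm.continuousOn.prodMk (huC.continuousOn.mono ball_subset_closedBall)
    refine hf.1.comp h1 ?_
    intro x hx
    refine ⟨⟨norm_nonneg _, ?_⟩, hupos x (ball_subset_closedBall hx)⟩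
    simpa using (mem_ball_zero_iff.1 hx).le
  have hopen : ∀ j, IsOpen (A j) := fun j => isOpen_ball.sdiff isClosed_closedBall
  have hsub : ∀ j ∈ K, A j ⊆ ball (0 : EuclideanSpace ℝ (Fin N)) R := by
    intro j hj x hx
    rw [hcover]
    exact Or.inl (mem_biUnion hj hx)
  have hmemA : ∀ j x, x ∈ A j ↔ ri j < ‖x - z j‖ ∧ ‖x - z j‖ < ro j := by
    intro j x
    simp only [hA, mem_sdiff, mem_ball, mem_closedBall, dist_eq_norm, not_le]
    exact and_comm
  -- points with nonzero gradient lie in some annulus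
  have hgrad : ∀ x ∈ ball (0 : EuclideanSpace ℝ (Fin N)) R, gradient u x ≠ 0 →
      ∃ j ∈ K, x ∈ A j := by
    intro x hx hne
    rw [hcover] at hx
    rcases hx with h | h
    · obtain ⟨j, hj, hxj⟩ := mem_iUnion₂.1 h
      exact ⟨j, hj, hxj⟩
    · exact absurd h.2 hne
  have hnotin : ∀ j ∈ K, ∀ q, q ∈ closure (A j) → q ∉ A j → ∀ i ∈ K, q ∉ A i := by
    intro j hj q hq hqj i hi hqi
    obtain ⟨x, hxi, hxj⟩ := _root_.mem_closure_iff.1 hq (A i) (hopen i) hqi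
    by_cases hij : i = j
    · exact hqj (hij ▸ hqi)
    · exact Set.disjoint_left.1 (hdisj hi hj hij) hxi hxj
  have hbcl : ∀ j ∈ K, ∀ q, ‖q - z j‖ ∈ Icc (ri j) (ro j) → q ∈ closure (A j) := by
    intro j hj q hq
    obtain ⟨ν, hν, hqν⟩ := exists_unit_dir hN q (z j)
    rw [hqν]
    exact ann_closure_dir hν (hdata j hj).2.1 (hdata j hj).2.2 hq
  have hbd : ∀ j ∈ K, ∀ q ∈ ball (0 : EuclideanSpace ℝ (Fin N)) R,
      ‖q - z j‖ = ri j ∨ ‖q - z j‖ = ro j →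
      U' j ‖q - z j‖ = 0 ∧ u q = U j ‖q - z j‖ := by
    intro j hj q hq hor
    have hlt := (hdata j hj).2.2
    have hIcc : ‖q - z j‖ ∈ Icc (ri j) (ro j) := by
      rcases hor with h | h <;> rw [h] <;> constructor <;> linarith
    have hqj : q ∉ A j := by
      rw [hmemA]
      rintro ⟨h1, h2⟩
      rcases hor with h | h <;> linarith
    have hg0 : gradient u q = 0 := by
      by_contra hne
      obtain ⟨i, hi, hqi⟩ := hgrad q hq hne
      exact hnotin j hj q (hbcl j hj q hIcc) hqj i hi hqi
    exact ann_bdry_deriv hN (hdata j hj).2.1 hlt (hprof j hj).1 (hprof j hj).2.1 hg0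
      (contAt_gradient huC hq)
      ((huC.continuousOn.mono ball_subset_closedBall).continuousAt (isOpen_ball.mem_nhds hq)) hIcc
  have hin : ∀ j ∈ K, ∀ q ∈ ball (0 : EuclideanSpace ℝ (Fin N)) R, ‖q - z j‖ = ri j →
      0 ≤ f ‖q‖ (u q) := by
    intro j hj q hq h
    have hd := (hbd j hj q hq (Or.inl h)).1
    rw [h] at hd
    exact ann_inner hN hg hdist hcont (hdata j hj).2.1 (hdata j hj).2.2 (hprof j hj).1
      (hprof j hj).2.1 (hprof j hj).2.2.1 hd hq h
  have hout : ∀ j ∈ K, ∀ q ∈ ball (0 : EuclideanSpace ℝ (Fin N)) R, ‖q - z j‖ = ro j →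
      f ‖q‖ (u q) ≤ 0 := by
    intro j hj q hq h
    have hd := (hbd j hj q hq (Or.inr h)).1
    rw [h] at hd
    exact ann_outer hN hg hdist hcont (hdata j hj).2.1 (hdata j hj).2.2 (hprof j hj).1
      (hprof j hj).2.1 (hprof j hj).2.2.1 hd hq h
  have hca : ContinuousAt (fun x => f ‖x‖ (u x)) x₀ := hcont.continuousAt (isOpen_ball.mem_nhds hx₀)
  by_contra hne
  -- the ball `B` on which `f` does not vanish
  obtain ⟨ε, hε, hB⟩ : ∃ ε > 0, ∀ x ∈ ball x₀ ε, x ∈ ball (0 : EuclideanSpace ℝ (Fin N)) R ∧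
      0 < f ‖x‖ (u x) * f ‖x₀‖ (u x₀) := by
    apply Metric.eventually_nhds_iff_ball.1
    refine (isOpen_ball.eventually_mem hx₀).and ?_
    refine (hca.mul continuousAt_const).eventually_const_lt ?_
    exact mul_self_pos.2 hne
  -- only finitely many annuli meet the smaller ball
  have hfin : {j | j ∈ K ∧ (A j ∩ ball x₀ (ε / 2)).Nonempty}.Finite := by
    refine (finite_balls (A := A) hdisj (fun j _ => hopen j) hsub
      (by positivity : 0 < ε / 4)).subset ?_
    rintro j ⟨hj, p, hpA, hpB⟩
    refine ⟨hj, ?_⟩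
    rw [hmemA] at hpA
    obtain ⟨ν, hν, hpν⟩ := exists_unit_dir hN p (z j)
    set s := ‖p - z j‖ with hs
    have hri0 := (hdata j hj).2.1
    have hpt : ∀ r : ℝ, 0 ≤ r → ‖z j + r • ν - z j‖ = r := by
      intro r hr
      rw [add_sub_cancel_left, norm_smul, hν, Real.norm_eq_abs, abs_of_nonneg hr, mul_one]
    have hdistp : ∀ r : ℝ, |r - s| < ε / 2 → z j + r • ν ∈ ball x₀ ε := by
      intro r hr
      have e : z j + r • ν - p = (r - s) • ν := by
        conv_lhs => rw [hpν]
        module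
      rw [mem_ball, dist_eq_norm] at hpB ⊢
      have h1 := norm_sub_le_norm_sub_add_norm_sub (z j + r • ν) p x₀
      rw [e, norm_smul, hν, Real.norm_eq_abs, mul_one] at h1
      linarith
    have hballsub : ∀ r : ℝ, ri j + ε / 4 ≤ r → r + ε / 4 ≤ ro j →
        ball (z j + r • ν) (ε / 4) ⊆ A j := by
      intro r h1 h2 x hx
      rw [mem_ball, dist_eq_norm] at hx
      rw [hmemA]
      have hr0 : 0 ≤ r := by linarith
      have h3 := norm_sub_le_norm_sub_add_norm_sub x (z j + r • ν) (z j)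
      have h4 := norm_sub_le_norm_sub_add_norm_sub (z j + r • ν) x (z j)
      rw [norm_sub_rev _ x] at h4
      rw [hpt r hr0] at h3 h4
      constructor <;> linarith
    rcases lt_or_gt_of_ne hne with hlt | hgt
    · have hfar : ε / 2 ≤ s - ri j := by
        by_contra hcon
        push Not at hcon
        have hmem := hB _ (hdistp (ri j) (by rw [abs_lt]; constructor <;> linarith [hpA.1]))
        have := hin j hj _ hmem.1 (hpt _ hri0)
        nlinarith [hmem.2]
      exact ⟨_, hballsub (s - ε / 4) (by linarith) (by linarith [hpA.2])⟩
    · have hfar : ε / 2 ≤ ro j - s := by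
        by_contra hcon
        push Not at hcon
        have hmem := hB _ (hdistp (ro j) (by rw [abs_lt]; constructor <;> linarith [hpA.2]))
        have := hout j hj _ hmem.1 (hpt _ (by linarith [hpA.1, hpA.2]))
        nlinarith [hmem.2]
      exact ⟨_, hballsub (s + ε / 4) (by linarith [hpA.1]) (by linarith)⟩
  set J := {j | j ∈ K ∧ (A j ∩ ball x₀ (ε / 2)).Nonempty} with hJ
  -- the annuli are dense near `x₀`
  have hdense : ∀ V : Set (EuclideanSpace ℝ (Fin N)), IsOpen V → V ⊆ ball x₀ (ε / 2) →
      V.Nonempty → ∃ p ∈ V, ∃ j ∈ J, p ∈ A j := by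
    rintro V hV hVs ⟨p, hp⟩
    have hVs' : V ⊆ ball x₀ ε := hVs.trans (ball_subset_ball (by linarith))
    have hpf : f ‖p‖ (u p) ≠ 0 := by
      intro h
      have := (hB p (hVs' hp)).2
      rw [h, zero_mul] at this
      exact lt_irrefl _ this
    obtain ⟨p', hp', hg'⟩ := nonconst hdist hcont hV (fun x hx => (hB x (hVs' hx)).1) hp hpf
    obtain ⟨j, hj, hpj⟩ := hgrad p' (hB p' (hVs' hp')).1 hg'
    exact ⟨p', hp', j, ⟨hj, p', hpj, hVs hp'⟩, hpj⟩
  have hx₀J : ∀ j ∈ K, x₀ ∈ closure (A j) → x₀ ∉ A j → ‖x₀ - z j‖ = ri j ∨ ‖x₀ - z j‖ = ro j := by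
    intro j hj hcl hnot
    have h1 := ann_closure_sub hcl
    simp only [mem_sdiff, mem_ball, mem_closedBall, dist_eq_norm, not_lt] at h1
    rw [hmemA] at hnot
    by_contra hcon
    push Not at hcon
    exact hnot ⟨lt_of_le_of_ne h1.2 (Ne.symm hcon.1), lt_of_le_of_ne h1.1 hcon.2⟩
  have hlek := (hdata k hk).2.2
  rcases hcase with ⟨hsph, hri⟩ | ⟨hsph, hN2⟩
  · rw [mem_sphere, dist_eq_norm] at hsph
    have hpos : 0 < f ‖x₀‖ (u x₀) := lt_of_le_of_ne (hin k hk x₀ hx₀ hsph) (Ne.symm hne)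
    have hx₀k : x₀ ∈ closure (A k) := hbcl k hk x₀ (by rw [hsph]; exact ⟨le_rfl, hlek.le⟩)
    have hx₀nk : x₀ ∉ A k := by rw [hmemA]; intro h; linarith [h.1]
    have hclb : x₀ ∈ closure (ball (z k) (ri k)) := by
      rw [closure_ball _ hri.ne', mem_closedBall, dist_eq_norm, hsph]
    have hcl : x₀ ∈ closure (⋃ j ∈ J, A j ∩ ball (z k) (ri k)) := by
      rw [_root_.mem_closure_iff]
      intro o ho hxo
      obtain ⟨y, hy1, hy2⟩ := _root_.mem_closure_iff.1 hclb (o ∩ ball x₀ (ε / 2)) (ho.inter isOpen_ball)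
        ⟨hxo, mem_ball_self (by positivity)⟩
      obtain ⟨p, hp, j, hj, hpj⟩ := hdense ((o ∩ ball x₀ (ε / 2)) ∩ ball (z k) (ri k))
        ((ho.inter isOpen_ball).inter isOpen_ball) (fun x hx => hx.1.2) ⟨y, hy1, hy2⟩
      exact ⟨p, hp.1.1, mem_biUnion hj ⟨hpj, hp.2⟩⟩
    rw [hfin.closure_biUnion] at hcl
    simp only [mem_iUnion] at hcl
    obtain ⟨j, hj, hxj⟩ := hcl
    obtain ⟨p, hpA, hpb⟩ := closure_nonempty_iff.1 ⟨x₀, hxj⟩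
    have hxnot := hnotin k hk x₀ hx₀k hx₀nk j hj.1
    have hrij : ‖x₀ - z j‖ = ri j := by
      rcases hx₀J j hj.1 (closure_mono inter_subset_left hxj) hxnot with h | h
      · exact h
      · have := hout j hj.1 x₀ hx₀ h
        linarith
    have hu1 := (hbd j hj.1 x₀ hx₀ (Or.inl hrij)).2
    have hu2 := (hbd k hk x₀ hx₀ (Or.inl hsph)).2
    rw [hrij] at hu1
    rw [hsph] at hu2
    have hup := (hprof j hj.1).2.1 p hpA
    rw [hmemA] at hpA
    have hanti := ann_strictAnti (hprof j hj.1).1 (hprof j hj.1).2.2.1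
      ⟨le_rfl, (hdata j hj.1).2.2.le⟩ ⟨hpA.1.le, hpA.2.le⟩ hpA.1
    have := (hprof k hk).2.2.2 p hpb
    linarith
  · rw [mem_sphere, dist_eq_norm] at hsph
    have hlt0 : f ‖x₀‖ (u x₀) < 0 := lt_of_le_of_ne (hout k hk x₀ hx₀ hsph) hne
    have hx₀k : x₀ ∈ closure (A k) := hbcl k hk x₀ (by rw [hsph]; exact ⟨hlek.le, le_rfl⟩)
    have hx₀nk : x₀ ∉ A k := by rw [hmemA]; intro h; linarith [h.2]
    obtain ⟨e, he0, hek⟩ := exists_perp hN2 (x₀ - z k)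
    have hc : Continuous fun t : ℝ => x₀ + t • e := by fun_prop
    set T : Set (EuclideanSpace ℝ (Fin N)) := (fun t : ℝ => x₀ + t • e) '' Ioi 0 with hT
    have hx₀T : x₀ ∈ closure T := by
      have h0 : (0 : ℝ) ∈ closure (Ioi (0 : ℝ)) := by rw [closure_Ioi]; exact self_mem_Ici
      have := map_mem_closure (f := fun t : ℝ => x₀ + t • e) hc h0 (mapsTo_image _ _)
      simpa using this
    have hcl : x₀ ∈ closure (⋃ j ∈ J, T ∩ closure (A j)) := by
      rw [_root_.mem_closure_iff]
      intro o ho hxo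
      obtain ⟨y, hy1, hy2⟩ := _root_.mem_closure_iff.1 hx₀T (o ∩ ball x₀ (ε / 2)) (ho.inter isOpen_ball)
        ⟨hxo, mem_ball_self (by positivity)⟩
      have hyc : y ∈ closure (⋃ j ∈ J, A j) := by
        rw [_root_.mem_closure_iff]
        intro o' ho' hyo'
        obtain ⟨p, hp, j, hj, hpj⟩ := hdense (o' ∩ ball x₀ (ε / 2)) (ho'.inter isOpen_ball)
          (fun x hx => hx.2) ⟨y, hyo', hy1.2⟩
        exact ⟨p, hp.1, mem_biUnion hj hpj⟩
      rw [hfin.closure_biUnion] at hyc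
      simp only [mem_iUnion] at hyc
      obtain ⟨j, hj, hyj⟩ := hyc
      exact ⟨y, hy1.1, mem_biUnion hj ⟨hy2, hyj⟩⟩
    rw [hfin.closure_biUnion] at hcl
    simp only [mem_iUnion] at hcl
    obtain ⟨j, hj, hxj⟩ := hcl
    obtain ⟨y, ⟨t, ht, rfl⟩, hyj⟩ := closure_nonempty_iff.1 ⟨x₀, hxj⟩
    have ht0 : (0 : ℝ) < t := ht
    have hxjc : x₀ ∈ closure (A j) := by
      have := closure_mono inter_subset_right hxj
      rwa [closure_closure] at this
    have hxnot := hnotin k hk x₀ hx₀k hx₀nk j hj.1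
    have hroj : ‖x₀ - z j‖ = ro j := by
      rcases hx₀J j hj.1 hxjc hxnot with h | h
      · have := hin j hj.1 x₀ hx₀ h
        linarith
      · exact h
    have hyro := (ann_closure_sub hyj).1
    rw [mem_closedBall, dist_eq_norm] at hyro
    have hperp : ⟪x₀ - z j, e⟫ = 0 := by
      by_cases hjk : j = k
      · rw [hjk]; exact hek
      · have htan := tangent_balls (hdata k hk).2.1 (hdata k hk).2.2 (hdata j hj.1).2.1
          (hdata j hj.1).2.2 hsph hroj (hdisj hk hj.1 (Ne.symm hjk))
        have h1 := congrArg (fun w => ⟪w, e⟫) htan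
        simp only [real_inner_smul_left, inner_neg_left, hek, mul_zero] at h1
        have hrok : 0 < ro k := lt_of_le_of_lt (hdata k hk).2.1 hlek
        have h2 : ro k * ⟪x₀ - z j, e⟫ = 0 := by linarith
        exact (mul_eq_zero.1 h2).resolve_left hrok.ne'
    have hgt := perp_norm_gt he0 hperp ht0
    have e1 : x₀ + t • e - z j = x₀ - z j + t • e := by abel
    rw [e1] at hyro
    linarith
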